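/- If n is a product of 2, 3, or 4 pairwise distinct primes (i.e., n is squarefree with 2 ≤ ω(n) ≤ 4 prime divisors), then the n×n square has no perfect Mondrian partition. -/

import Mathlib

/-- An axis-aligned rectangle with integer coordinates placed on the grid:
lower-left corner `(x, y)`, width `w`, and height `h`. -/
structure Rect where
  x : ℕ
  y : ℕ
  w : ℕ
  h : ℕ
deriving DecidableEq

/-- The area of a rectangle. -/
def Rect.area (r : Rect) : ℕ := r.w * r.h

/-- Two rectangles are congruent if they have the same dimensions,
possibly after a ninety-degree rotation. -/
def Rect.Congruent (r s : Rect) : Prop :=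
  (r.w = s.w ∧ r.h = s.h) ∨ (r.w = s.h ∧ r.h = s.w)

/-- The rectangle `r` covers the unit grid cell `[i, i+1) × [j, j+1)`. -/
def Rect.Covers (r : Rect) (i j : ℕ) : Prop :=
  r.x ≤ i ∧ i < r.x + r.w ∧ r.y ≤ j ∧ j < r.y + r.h

/-- A Mondrian partition of the `n × n` square: a finite collection of
pairwise non-congruent rectangles with positive integer side lengths that
tile the square (every cell of the square is covered by exactly one
rectangle, and rectangles lie inside the square). -/
structure Mondrian (n : ℕ) where
  rects : Finset Rect
  pos : ∀ r ∈ rects, 0 < r.w ∧ 0 < r.h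
  inside : ∀ r ∈ rects, r.x + r.w ≤ n ∧ r.y + r.h ≤ n
  cover : ∀ i j : ℕ, i < n → j < n → ∃! r : Rect, r ∈ rects ∧ r.Covers i j
  noncong : ∀ r ∈ rects, ∀ s ∈ rects, r ≠ s → ¬ r.Congruent s

/-- The defect of a Mondrian partition: the difference between the largest
and the smallest rectangle areas. -/
def Mondrian.defect {n : ℕ} (P : Mondrian n) : ℕ :=
  P.rects.sup fun r => P.rects.sup fun s => r.area - s.area

/-- A Mondrian partition is perfect if all its rectangles have the same area. -/
def Mondrian.IsPerfect {n : ℕ} (P : Mondrian n) : Prop :=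
  ∀ r ∈ P.rects, ∀ s ∈ P.rects, r.area = s.area

/-- `mondrianDk n k` is the minimum defect over all Mondrian partitions of the
`n × n` square using exactly `k` rectangles. -/
noncomputable def mondrianDk (n k : ℕ) : ℕ :=
  sInf {d | ∃ P : Mondrian n, P.rects.card = k ∧ P.defect = d}

/-- `mondrianD n` is the minimum defect over all Mondrian partitions of the
`n × n` square (into at least two rectangles). -/
noncomputable def mondrianD (n : ℕ) : ℕ :=
  sInf {d | ∃ P : Mondrian n, 2 ≤ P.rects.card ∧ P.defect = d}

namespace Rect

/-- The reflection of a rectangle in the main diagonal. -/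
def transpose (r : Rect) : Rect := ⟨r.y, r.x, r.h, r.w⟩

lemma transpose_transpose (r : Rect) : r.transpose.transpose = r := rfl

lemma transpose_injective : Function.Injective transpose := fun r s h => by
  simpa [transpose_transpose] using congrArg transpose h

end Rect

namespace Mondrian

variable {n : ℕ}

/-- The reflection of a partition in the main diagonal. -/
def transpose (P : Mondrian n) : Mondrian n where
  rects := P.rects.image Rect.transpose
  pos := by
    simp only [Finset.forall_mem_image]
    exact fun r hr => (P.pos r hr).symm
  inside := by
    simp only [Finset.forall_mem_image]
    exact fun r hr => (P.inside r hr).symm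
  cover := by
    intro i j hi hj
    obtain ⟨r, ⟨hr, h1, h2, h3, h4⟩, huniq⟩ := P.cover j i hj hi
    refine ⟨r.transpose, ⟨Finset.mem_image_of_mem _ hr, h3, h4, h1, h2⟩, ?_⟩
    rintro s ⟨hs, g1, g2, g3, g4⟩
    obtain ⟨t, ht, rfl⟩ := Finset.mem_image.1 hs
    rw [huniq t ⟨ht, g3, g4, g1, g2⟩]
  noncong := by
    simp only [Finset.forall_mem_image]
    intro r hr s hs hne hc
    refine P.noncong r hr s hs (fun h => hne (h ▸ rfl)) ?_
    simp only [Rect.Congruent, Rect.transpose] at hc ⊢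
    tauto

lemma mem_transpose {P : Mondrian n} {r : Rect} :
    r.transpose ∈ P.transpose.rects ↔ r ∈ P.rects := by
  simp [transpose, Rect.transpose_injective.eq_iff]

lemma card_transpose (P : Mondrian n) : P.transpose.rects.card = P.rects.card :=
  Finset.card_image_of_injective _ Rect.transpose_injective

lemma IsPerfect.transpose {P : Mondrian n} (h : P.IsPerfect) : P.transpose.IsPerfect := by
  intro r' hr' s' hs'
  obtain ⟨r, hr, rfl⟩ := Finset.mem_image.1 hr'
  obtain ⟨s, hs, rfl⟩ := Finset.mem_image.1 hs'
  have := h r hr s hs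
  simp only [Rect.area, Rect.transpose] at *
  linarith [mul_comm r.w r.h, mul_comm s.w s.h]

/-- The rectangles that meet the `j`-th row of cells. -/
def row (P : Mondrian n) (j : ℕ) : Finset Rect :=
  P.rects.filter fun r => r.y ≤ j ∧ j < r.y + r.h

/-- The rectangles that meet the `i`-th column of cells. -/
def col (P : Mondrian n) (i : ℕ) : Finset Rect :=
  P.rects.filter fun r => r.x ≤ i ∧ i < r.x + r.w

lemma mem_row {P : Mondrian n} {j : ℕ} {r : Rect} :
    r ∈ P.row j ↔ r ∈ P.rects ∧ r.y ≤ j ∧ j < r.y + r.h := Finset.mem_filter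

lemma mem_col {P : Mondrian n} {i : ℕ} {r : Rect} :
    r ∈ P.col i ↔ r ∈ P.rects ∧ r.x ≤ i ∧ i < r.x + r.w := Finset.mem_filter

lemma exists_mem_row_col (P : Mondrian n) {i j : ℕ} (hi : i < n) (hj : j < n) :
    ∃ r, r ∈ P.row j ∧ r ∈ P.col i := by
  obtain ⟨r, ⟨hr, h1, h2, h3, h4⟩, -⟩ := P.cover i j hi hj
  exact ⟨r, mem_row.2 ⟨hr, h3, h4⟩, mem_col.2 ⟨hr, h1, h2⟩⟩

lemma eq_of_mem_row_col {P : Mondrian n} {i j : ℕ} {r s : Rect}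
    (hr : r ∈ P.row j) (hr' : r ∈ P.col i) (hs : s ∈ P.row j) (hs' : s ∈ P.col i) : r = s := by
  rw [mem_row] at hr hs
  rw [mem_col] at hr' hs'
  have := P.inside r hr.1
  exact (P.cover i j (by omega) (by omega)).unique
    ⟨hr.1, hr'.2.1, hr'.2.2, hr.2.1, hr.2.2⟩ ⟨hs.1, hs'.2.1, hs'.2.2, hs.2.1, hs.2.2⟩

lemma sum_row (P : Mondrian n) {j : ℕ} (hj : j < n) : ∑ r ∈ P.row j, r.w = n := by
  have h : (P.row j).biUnion (fun r => Finset.Ico r.x (r.x + r.w)) = Finset.range n := by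
    ext i
    simp only [Finset.mem_biUnion, Finset.mem_Ico, Finset.mem_range]
    constructor
    · rintro ⟨r, hr, h1, h2⟩
      have := P.inside r (mem_row.1 hr).1
      omega
    · intro hi
      obtain ⟨r, hr, hr'⟩ := P.exists_mem_row_col hi hj
      exact ⟨r, hr, (mem_col.1 hr').2⟩
  have hd : ∀ r ∈ P.row j, ∀ s ∈ P.row j, r ≠ s →
      Disjoint (Finset.Ico r.x (r.x + r.w)) (Finset.Ico s.x (s.x + s.w)) := by
    intro r hr s hs hne
    rw [Finset.disjoint_left]
    intro i hi hi'
    rw [Finset.mem_Ico] at hi hi'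
    exact hne (eq_of_mem_row_col hr (mem_col.2 ⟨(mem_row.1 hr).1, hi⟩) hs
      (mem_col.2 ⟨(mem_row.1 hs).1, hi'⟩))
  have := Finset.card_biUnion hd
  rw [h] at this
  simpa using this.symm

lemma row_transpose (P : Mondrian n) (i : ℕ) :
    P.transpose.row i = (P.col i).image Rect.transpose := by
  ext r
  rw [← Rect.transpose_transpose r, mem_row, mem_transpose,
    Rect.transpose_injective.mem_finset_image, mem_col]
  rfl

lemma sum_col (P : Mondrian n) {i : ℕ} (hi : i < n) : ∑ r ∈ P.col i, r.h = n := by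
  have := P.transpose.sum_row hi
  rw [row_transpose, Finset.sum_image (Rect.transpose_injective.injOn)] at this
  exact this

lemma sum_area (P : Mondrian n) : ∑ r ∈ P.rects, r.area = n ^ 2 := by
  have h1 : ∑ j ∈ Finset.range n, ∑ r ∈ P.row j, r.w = n ^ 2 := by
    rw [Finset.sum_congr rfl fun j hj => P.sum_row (Finset.mem_range.1 hj)]
    simp [sq]
  rw [← h1]
  simp only [row, Finset.sum_filter]
  rw [Finset.sum_comm]
  refine Finset.sum_congr rfl fun r hr => ?_
  have : (Finset.range n).filter (fun j => r.y ≤ j ∧ j < r.y + r.h)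
      = Finset.Ico r.y (r.y + r.h) := by
    ext j
    have := P.inside r hr
    simp only [Finset.mem_filter, Finset.mem_range, Finset.mem_Ico]
    omega
  rw [← Finset.sum_filter, this]
  simp [Rect.area, mul_comm]

lemma row_subset (P : Mondrian n) (j : ℕ) : P.row j ⊆ P.rects := Finset.filter_subset _ _

lemma col_subset (P : Mondrian n) (i : ℕ) : P.col i ⊆ P.rects := Finset.filter_subset _ _

namespace IsPerfect

variable {P : Mondrian n}

lemma eq_of_w_eq (hP : P.IsPerfect) {r s : Rect} (hr : r ∈ P.rects) (hs : s ∈ P.rects)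
    (h : r.w = s.w) : r = s := by
  by_contra hne
  refine P.noncong r hr s hs hne (Or.inl ⟨h, ?_⟩)
  have h1 := hP r hr s hs
  simp only [Rect.area, h] at h1
  exact Nat.eq_of_mul_eq_mul_left (P.pos s hs).1 h1

lemma eq_of_h_eq (hP : P.IsPerfect) {r s : Rect} (hr : r ∈ P.rects) (hs : s ∈ P.rects)
    (h : r.h = s.h) : r = s := by
  by_contra hne
  refine P.noncong r hr s hs hne (Or.inl ⟨?_, h⟩)
  have h1 := hP r hr s hs
  simp only [Rect.area, h] at h1
  exact Nat.eq_of_mul_eq_mul_right (P.pos s hs).2 h1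

lemma eq_of_w_eq_h (hP : P.IsPerfect) {r s : Rect} (hr : r ∈ P.rects) (hs : s ∈ P.rects)
    (h : r.w = s.h) : r = s := by
  by_contra hne
  refine P.noncong r hr s hs hne (Or.inr ⟨h, ?_⟩)
  have h1 := hP r hr s hs
  simp only [Rect.area, h] at h1
  rw [mul_comm s.w] at h1
  exact Nat.eq_of_mul_eq_mul_left (P.pos s hs).2 h1

lemma card_mul (hP : P.IsPerfect) {r : Rect} (hr : r ∈ P.rects) :
    P.rects.card * r.area = n ^ 2 := by
  rw [← P.sum_area, Finset.sum_congr rfl fun s hs => hP s hs r hr, Finset.sum_const, smul_eq_mul]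

/-- Rectangles meeting the same rows coincide. -/
lemma eq_of_row_iff (hP : P.IsPerfect) {r s : Rect} (hr : r ∈ P.rects) (hs : s ∈ P.rects)
    (h : ∀ j, j < n → (r ∈ P.row j ↔ s ∈ P.row j)) : r = s := by
  have h1 := P.pos r hr
  have h2 := P.pos s hs
  have h3 := P.inside r hr
  have h4 := P.inside s hs
  have key : ∀ j, j < n → ((r.y ≤ j ∧ j < r.y + r.h) ↔ (s.y ≤ j ∧ j < s.y + s.h)) := by
    intro j hj
    have := h j hj
    rw [mem_row, mem_row] at this
    tauto
  refine hP.eq_of_h_eq hr hs ?_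
  have a := key r.y (by omega)
  have b := key s.y (by omega)
  have c := key (r.y + r.h - 1) (by omega)
  have d := key (s.y + s.h - 1) (by omega)
  omega

end IsPerfect

/-- The rectangles that meet neither the column `a` nor the column `b`. -/
def middle (P : Mondrian n) (a b : ℕ) : Finset Rect :=
  P.rects.filter fun r => r ∉ P.col a ∧ r ∉ P.col b

lemma mem_middle {P : Mondrian n} {a b : ℕ} {r : Rect} :
    r ∈ P.middle a b ↔ r ∈ P.rects ∧ r ∉ P.col a ∧ r ∉ P.col b := Finset.mem_filter

lemma middle_comm (P : Mondrian n) (a b : ℕ) : P.middle a b = P.middle b a := by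
  ext r
  simp only [mem_middle]
  tauto

lemma mem_row_y {P : Mondrian n} {r : Rect} (hr : r ∈ P.rects) : r ∈ P.row r.y :=
  mem_row.2 ⟨hr, le_rfl, by have := (P.pos r hr).2; omega⟩

lemma mem_col_x {P : Mondrian n} {r : Rect} (hr : r ∈ P.rects) : r ∈ P.col r.x :=
  mem_col.2 ⟨hr, le_rfl, by have := (P.pos r hr).1; omega⟩

lemma y_lt {P : Mondrian n} {r : Rect} (hr : r ∈ P.rects) : r.y < n := by
  have := P.inside r hr
  have := P.pos r hr
  omega

lemma x_lt {P : Mondrian n} {r : Rect} (hr : r ∈ P.rects) : r.x < n := by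
  have := P.inside r hr
  have := P.pos r hr
  omega

lemma card_col_add_card_col_add_card_middle (P : Mondrian n) {a b : ℕ}
    (hab : ∀ r ∈ P.col a, r ∉ P.col b) :
    (P.col a).card + (P.col b).card + (P.middle a b).card = P.rects.card := by
  have h1 : Disjoint (P.col a) (P.col b) := Finset.disjoint_left.2 hab
  have h2 : Disjoint (P.col a ∪ P.col b) (P.middle a b) := by
    rw [Finset.disjoint_left]
    intro r hr hm
    have := mem_middle.1 hm
    rcases Finset.mem_union.1 hr with h | h <;> tauto
  rw [← Finset.card_union_of_disjoint h1, ← Finset.card_union_of_disjoint h2]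
  congr 1
  ext r
  simp only [Finset.mem_union, mem_middle]
  constructor
  · rintro ((h | h) | h)
    · exact (mem_col.1 h).1
    · exact (mem_col.1 h).1
    · exact h.1
  · tauto

lemma w_add_w_add_sum_middle (P : Mondrian n) {a b j : ℕ} (hab : ∀ r ∈ P.col a, r ∉ P.col b)
    (hj : j < n) {r s : Rect} (hr : r ∈ P.col a) (hrj : r ∈ P.row j) (hs : s ∈ P.col b)
    (hsj : s ∈ P.row j) :
    r.w + s.w + ∑ t ∈ P.middle a b, (if t ∈ P.row j then t.w else 0) = n := by
  have hrs : r ≠ s := by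
    rintro rfl
    exact hab r hr hs
  rw [← Finset.sum_filter, ← Finset.sum_pair (f := Rect.w) hrs, ← Finset.sum_union]
  · refine Eq.trans (Finset.sum_congr ?_ fun _ _ => rfl) (P.sum_row hj)
    ext t
    simp only [Finset.mem_union, Finset.mem_insert, Finset.mem_singleton, Finset.mem_filter,
      mem_middle]
    constructor
    · rintro ((rfl | rfl) | h)
      · exact hrj
      · exact hsj
      · exact h.2
    · intro ht
      by_cases h1 : t ∈ P.col a
      · exact Or.inl (Or.inl (eq_of_mem_row_col ht h1 hrj hr))
      by_cases h2 : t ∈ P.col b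
      · exact Or.inl (Or.inr (eq_of_mem_row_col ht h2 hsj hs))
      exact Or.inr ⟨⟨(mem_row.1 ht).1, h1, h2⟩, ht⟩
  · rw [Finset.disjoint_left]
    intro t ht ht'
    simp only [Finset.mem_insert, Finset.mem_singleton] at ht
    have := mem_middle.1 (Finset.mem_filter.1 ht').1
    rcases ht with rfl | rfl <;> tauto

lemma col_nonempty (P : Mondrian n) {a : ℕ} (ha : a < n) : (P.col a).Nonempty := by
  obtain ⟨r, -, hr⟩ := P.exists_mem_row_col ha ha
  exact ⟨r, hr⟩

lemma mem_row_of_col_eq_singleton {P : Mondrian n} {a j : ℕ} (ha : a < n) (hj : j < n) {r : Rect}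
    (h : P.col a = {r}) : r ∈ P.row j := by
  obtain ⟨s, hs, hs'⟩ := P.exists_mem_row_col ha hj
  rw [h, Finset.mem_singleton] at hs'
  exact hs' ▸ hs

lemma mem_row_or_of_col_eq_pair {P : Mondrian n} {a j : ℕ} (ha : a < n) (hj : j < n) {r s : Rect}
    (h : P.col a = {r, s}) : r ∈ P.row j ∨ s ∈ P.row j := by
  obtain ⟨t, ht, ht'⟩ := P.exists_mem_row_col ha hj
  rw [h, Finset.mem_insert, Finset.mem_singleton] at ht'
  rcases ht' with rfl | rfl
  · exact Or.inl ht
  · exact Or.inr ht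

namespace IsPerfect

variable {P : Mondrian n} {a b : ℕ}

/-- If the rectangles outside two columns contribute the same width to every row, then facing
rectangles in the two columns coincide. -/
lemma false_of_sum_middle_const (hP : P.IsPerfect) (ha : a < n) (hb : b < n)
    (hab : ∀ r ∈ P.col a, r ∉ P.col b) (c : ℕ)
    (hc : ∀ j < n, ∑ t ∈ P.middle a b, (if t ∈ P.row j then t.w else 0) = c) : False := by
  obtain ⟨r, hr, hr'⟩ := P.exists_mem_row_col ha ha
  obtain ⟨s, hs, hs'⟩ := P.exists_mem_row_col hb ha
  have h0 := P.w_add_w_add_sum_middle hab ha hr' hr hs' hs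
  rw [hc a ha] at h0
  have hrm := (mem_row.1 hr).1
  have hsm := (mem_row.1 hs).1
  have : r = s := by
    refine hP.eq_of_row_iff hrm hsm fun j hj => ⟨fun h => ?_, fun h => ?_⟩
    · obtain ⟨t, ht, ht'⟩ := P.exists_mem_row_col hb hj
      have h1 := P.w_add_w_add_sum_middle hab hj hr' h ht' ht
      rw [hc j hj] at h1
      rwa [hP.eq_of_w_eq hsm (mem_row.1 ht).1 (by omega)]
    · obtain ⟨t, ht, ht'⟩ := P.exists_mem_row_col ha hj
      have h1 := P.w_add_w_add_sum_middle hab hj ht' ht hs' h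
      rw [hc j hj] at h1
      rwa [hP.eq_of_w_eq hrm (mem_row.1 ht).1 (by omega)]
  exact hab r hr' (this ▸ hs')

lemma false_of_card_one_one (hP : P.IsPerfect) (ha : a < n) (hb : b < n)
    (hab : ∀ r ∈ P.col a, r ∉ P.col b) (h1 : (P.col a).card = 1) (h2 : (P.col b).card = 1) :
    False := by
  obtain ⟨r, hr⟩ := Finset.card_eq_one.1 h1
  obtain ⟨s, hs⟩ := Finset.card_eq_one.1 h2
  have hr' : r ∈ P.col a := by simp [hr]
  have hs' : s ∈ P.col b := by simp [hs]
  have : r = s := hP.eq_of_row_iff (mem_col.1 hr').1 (mem_col.1 hs').1 fun j hj =>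
    iff_of_true (mem_row_of_col_eq_singleton ha hj hr) (mem_row_of_col_eq_singleton hb hj hs)
  exact hab r hr' (this ▸ hs')

lemma false_of_card_one_three_one (hP : P.IsPerfect) (ha : a < n)
    (hab : ∀ r ∈ P.col a, r ∉ P.col b) (h1 : (P.col a).card = 1) (h2 : (P.col b).card = 3)
    (h3 : (P.middle a b).card = 1) : False := by
  obtain ⟨r, hr⟩ := Finset.card_eq_one.1 h1
  obtain ⟨m, hm⟩ := Finset.card_eq_one.1 h3
  obtain ⟨s, t, u, hst, hsu, htu, hs⟩ := Finset.card_eq_three.1 h2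
  have key : ∀ v ∈ P.col b, r.w + v.w = n ∨ r.w + v.w + m.w = n := by
    intro v hv
    have hvm := (mem_col.1 hv).1
    have := P.w_add_w_add_sum_middle hab (y_lt hvm) (by simp [hr] : r ∈ P.col a)
      (mem_row_of_col_eq_singleton ha (y_lt hvm) hr) hv (mem_row_y hvm)
    rw [hm, Finset.sum_singleton] at this
    split_ifs at this
    · exact Or.inr this
    · exact Or.inl this
  have ms : s ∈ P.col b := by simp [hs]
  have mt : t ∈ P.col b := by simp [hs]
  have mu : u ∈ P.col b := by simp [hs]
  have k1 := key s ms
  have k2 := key t mt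
  have k3 := key u mu
  have n1 : s.w ≠ t.w := fun h => hst (hP.eq_of_w_eq (mem_col.1 ms).1 (mem_col.1 mt).1 h)
  have n2 : s.w ≠ u.w := fun h => hsu (hP.eq_of_w_eq (mem_col.1 ms).1 (mem_col.1 mu).1 h)
  have n3 : t.w ≠ u.w := fun h => htu (hP.eq_of_w_eq (mem_col.1 mt).1 (mem_col.1 mu).1 h)
  omega

lemma false_of_card_one_two_two (hP : P.IsPerfect) (ha : a < n) (hb : b < n)
    (hab : ∀ r ∈ P.col a, r ∉ P.col b) (h1 : (P.col a).card = 1) (h2 : (P.col b).card = 2)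
    (h3 : (P.middle a b).card = 2) : False := by
  obtain ⟨r, hr⟩ := Finset.card_eq_one.1 h1
  obtain ⟨m, k, hmk, hm⟩ := Finset.card_eq_two.1 h3
  obtain ⟨s, t, hst, hs⟩ := Finset.card_eq_two.1 h2
  have mr : r ∈ P.col a := by simp [hr]
  have ms : s ∈ P.col b := by simp [hs]
  have mt : t ∈ P.col b := by simp [hs]
  have mm := mem_middle.1 (by simp [hm] : m ∈ P.middle a b)
  have mk := mem_middle.1 (by simp [hm] : k ∈ P.middle a b)
  have n1 : m.w ≠ k.w := fun h => hmk (hP.eq_of_w_eq mm.1 mk.1 h)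
  have n2 := (P.pos m mm.1).1
  have n3 := (P.pos k mk.1).1
  have key : ∀ v ∈ P.col b, ∀ i < n, ∀ j < n, v ∈ P.row i → v ∈ P.row j →
      m ∈ P.row i → m ∈ P.row j := by
    intro v hv i hi j hj hvi hvj hmi
    have e1 := P.w_add_w_add_sum_middle hab hi mr (mem_row_of_col_eq_singleton ha hi hr) hv hvi
    have e2 := P.w_add_w_add_sum_middle hab hj mr (mem_row_of_col_eq_singleton ha hj hr) hv hvj
    rw [hm, Finset.sum_pair hmk, if_pos hmi] at e1
    rw [hm, Finset.sum_pair hmk] at e2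
    by_contra hmj
    rw [if_neg hmj] at e2
    split_ifs at e1 e2 <;> omega
  have excl : ∀ i < n, ¬ (s ∈ P.row i ∧ t ∈ P.row i) := fun i hi h =>
    hst (eq_of_mem_row_col h.1 ms h.2 mt)
  have cov : ∀ i < n, s ∈ P.row i ∨ t ∈ P.row i := fun i hi => mem_row_or_of_col_eq_pair hb hi hs
  have hs1 := (mem_col.1 ms).1
  have ht1 := (mem_col.1 mt).1
  have hr1 := (mem_col.1 mr).1
  have ks := fun i hi => key s ms i hi
  have kt := fun i hi => key t mt i hi
  have sy := y_lt hs1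
  have ty := y_lt ht1
  have my := y_lt mm.1
  have sr := mem_row_y hs1
  have tr := mem_row_y ht1
  have mrow := mem_row_y mm.1
  by_cases c1 : m ∈ P.row s.y <;> by_cases c2 : m ∈ P.row t.y
  · have : m = r := hP.eq_of_row_iff mm.1 hr1 fun j hj =>
      iff_of_true (by
        rcases cov j hj with h | h
        · exact ks _ sy _ hj sr h c1
        · exact kt _ ty _ hj tr h c2) (mem_row_of_col_eq_singleton ha hj hr)
    exact mm.2.1 (this ▸ mr)
  · have : m = s := hP.eq_of_row_iff mm.1 hs1 fun j hj => ⟨fun h => by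
      rcases cov j hj with h' | h'
      · exact h'
      · exact absurd (kt _ hj _ ty h' tr h) c2, fun h => ks _ sy _ hj sr h c1⟩
    exact mm.2.2 (this ▸ ms)
  · have : m = t := hP.eq_of_row_iff mm.1 ht1 fun j hj => ⟨fun h => by
      rcases cov j hj with h' | h'
      · exact absurd (ks _ hj _ sy h' sr h) c1
      · exact h', fun h => kt _ ty _ hj tr h c2⟩
    exact mm.2.2 (this ▸ mt)
  · rcases cov m.y my with h | h
    · exact c1 (ks _ my _ sy h sr mrow)
    · exact c2 (kt _ my _ ty h tr mrow)

/-- A pinwheel of four rectangles around the rectangle `m` does not exist. -/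
lemma false_of_pinwheel (hP : P.IsPerfect) (ha : a < n) (hb : b < n)
    (hab : ∀ r ∈ P.col a, r ∉ P.col b) {r r' s s' m : Rect} (hr : P.col a = {r, r'})
    (hrr : r ≠ r') (hs : P.col b = {s, s'}) (hss : s ≠ s') (hm : P.middle a b = {m})
    (hrm : r ∈ P.col m.x) (hsm : s ∈ P.col m.x) (hcard : P.rects.card = 5) : False := by
  have mr : r ∈ P.col a := by simp [hr]
  have mr' : r' ∈ P.col a := by simp [hr]
  have ms : s ∈ P.col b := by simp [hs]
  have ms' : s' ∈ P.col b := by simp [hs]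
  have mm := mem_middle.1 (by simp [hm] : m ∈ P.middle a b)
  have hr1 := (mem_col.1 mr).1
  have hr1' := (mem_col.1 mr').1
  have hs1 := (mem_col.1 ms).1
  have hs1' := (mem_col.1 ms').1
  have hmx := mem_col_x mm.1
  have e1 := P.sum_col ha
  have e2 := P.sum_col hb
  rw [hr, Finset.sum_pair hrr] at e1
  rw [hs, Finset.sum_pair hss] at e2
  have e3 : r.w + s'.w = n := by
    have h1 := mem_row_y hr1
    have h2 : s' ∈ P.row r.y := by
      refine (mem_row_or_of_col_eq_pair hb (y_lt hr1) hs).resolve_left fun h => ?_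
      exact hab r mr (eq_of_mem_row_col h hsm h1 hrm ▸ ms)
    have := P.w_add_w_add_sum_middle hab (y_lt hr1) mr h1 ms' h2
    rwa [hm, Finset.sum_singleton, if_neg, add_zero] at this
    exact fun h => mm.2.1 (eq_of_mem_row_col h hmx h1 hrm ▸ mr)
  have e4 : r'.w + s.w = n := by
    have h1 := mem_row_y hs1
    have h2 : r' ∈ P.row s.y := by
      refine (mem_row_or_of_col_eq_pair ha (y_lt hs1) hr).resolve_left fun h => ?_
      exact hab r mr (eq_of_mem_row_col h hrm h1 hsm ▸ ms)
    have := P.w_add_w_add_sum_middle hab (y_lt hs1) mr' h2 ms h1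
    rwa [hm, Finset.sum_singleton, if_neg, add_zero] at this
    exact fun h => mm.2.2 (eq_of_mem_row_col h hmx h1 hsm ▸ ms)
  have a1 := hP.card_mul hr1
  have a2 := hP r' hr1' r hr1
  have a3 := hP s hs1 r hr1
  have a4 := hP s' hs1' r hr1
  have p1 := P.pos r hr1
  rw [hcard] at a1
  have hpos : 0 < r.area := Nat.mul_pos p1.1 p1.2
  have hne : r.w + r.h ≠ n := by
    intro h
    have : s' = r := hP.eq_of_w_eq_h hs1' hr1 (by omega)
    exact hab r mr (this ▸ ms')
  have hn : 0 < n := by omega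
  simp only [Rect.area] at a1 a2 a3 a4 hpos
  zify at *
  have hr'h : (r'.h : ℤ) = n - r.h := by linarith
  have hsh : (s.h : ℤ) = n - s'.h := by linarith
  have hs'w : (s'.w : ℤ) = n - r.w := by linarith
  have hsw : (s.w : ℤ) = n - r'.w := by linarith
  rw [hr'h] at a2
  rw [hsh, hsw] at a3
  rw [hs'w] at a4
  generalize hα : (r.w : ℤ) * r.h = α at *
  have key : (n : ℤ) * ((n - r.w - r.h) * (n ^ 2 - 2 * α)) = 0 := by
    linear_combination ((n : ℤ) - r.h) * (n - r.w) * a3 +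
      ((n : ℤ) * (n - r.w) - s'.h * (n - r.w)) * a2 + ((n : ℤ) * (n - r.h) - α) * a4
      - ((n : ℤ) ^ 2 - α) * hα
  rcases mul_eq_zero.1 key with h | h
  · omega
  rcases mul_eq_zero.1 h with h | h
  · exact hne (by linarith)
  · linarith

lemma false_of_card_two_two_one (hP : P.IsPerfect) (ha : a < n) (hb : b < n)
    (hab : ∀ r ∈ P.col a, r ∉ P.col b) (h1 : (P.col a).card = 2) (h2 : (P.col b).card = 2)
    (h3 : (P.middle a b).card = 1) (hcard : P.rects.card = 5) : False := by
  obtain ⟨r, r', hrr, hr⟩ := Finset.card_eq_two.1 h1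
  obtain ⟨s, s', hss, hs⟩ := Finset.card_eq_two.1 h2
  obtain ⟨m, hm⟩ := Finset.card_eq_one.1 h3
  have mr : r ∈ P.col a := by simp [hr]
  have mr' : r' ∈ P.col a := by simp [hr]
  have ms : s ∈ P.col b := by simp [hs]
  have ms' : s' ∈ P.col b := by simp [hs]
  have mm := mem_middle.1 (by simp [hm] : m ∈ P.middle a b)
  have hr1 := (mem_col.1 mr).1
  have hr1' := (mem_col.1 mr').1
  have hs1 := (mem_col.1 ms).1
  have hs1' := (mem_col.1 ms').1
  have hmn : m.h ≠ n := by
    intro h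
    refine hP.false_of_sum_middle_const ha hb hab m.w fun j hj => ?_
    have := P.inside m mm.1
    rw [hm, Finset.sum_singleton, if_pos (mem_row.2 ⟨mm.1, by omega, by omega⟩)]
  have e1 := P.sum_col ha
  have e2 := P.sum_col hb
  rw [hr, Finset.sum_pair hrr] at e1
  rw [hs, Finset.sum_pair hss] at e2
  have q1 : m.h ≠ r.h := fun h => mm.2.1 (hP.eq_of_h_eq mm.1 hr1 h ▸ mr)
  have q2 : m.h ≠ r'.h := fun h => mm.2.1 (hP.eq_of_h_eq mm.1 hr1' h ▸ mr')
  have q3 : m.h ≠ s.h := fun h => mm.2.2 (hP.eq_of_h_eq mm.1 hs1 h ▸ ms)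
  have q4 : m.h ≠ s'.h := fun h => mm.2.2 (hP.eq_of_h_eq mm.1 hs1' h ▸ ms')
  have hcol : m.h + (if r ∈ P.col m.x then r.h else 0) + (if r' ∈ P.col m.x then r'.h else 0)
      + (if s ∈ P.col m.x then s.h else 0) + (if s' ∈ P.col m.x then s'.h else 0) = n := by
    have hsplit : P.rects = insert m (insert r (insert r' (insert s {s'}))) := by
      ext t
      simp only [Finset.mem_insert, Finset.mem_singleton]
      constructor
      · intro ht
        by_cases c1 : t ∈ P.col a
        · rw [hr] at c1
          simp only [Finset.mem_insert, Finset.mem_singleton] at c1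
          tauto
        by_cases c2 : t ∈ P.col b
        · rw [hs] at c2
          simp only [Finset.mem_insert, Finset.mem_singleton] at c2
          tauto
        have : t ∈ P.middle a b := mem_middle.2 ⟨ht, c1, c2⟩
        rw [hm, Finset.mem_singleton] at this
        exact Or.inl this
      · rintro (rfl | rfl | rfl | rfl | rfl)
        exacts [mm.1, hr1, hr1', hs1, hs1']
    have h5 : ∑ t ∈ P.rects, (if t ∈ P.col m.x then t.h else 0) = n := by
      rw [← Finset.sum_filter]
      refine Eq.trans (Finset.sum_congr ?_ fun _ _ => rfl) (P.sum_col (x_lt mm.1))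
      ext t
      simp only [Finset.mem_filter, and_iff_right_iff_imp]
      exact fun h => (mem_col.1 h).1
    have d1 : r ≠ s := fun h => hab r mr (h ▸ ms)
    have d2 : r ≠ s' := fun h => hab r mr (h ▸ ms')
    have d3 : r' ≠ s := fun h => hab r' mr' (h ▸ ms)
    have d4 : r' ≠ s' := fun h => hab r' mr' (h ▸ ms')
    have d5 : m ≠ r := fun h => q1 (h ▸ rfl)
    have d6 : m ≠ r' := fun h => q2 (h ▸ rfl)
    have d7 : m ≠ s := fun h => q3 (h ▸ rfl)
    have d8 : m ≠ s' := fun h => q4 (h ▸ rfl)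
    rw [hsplit, Finset.sum_insert, Finset.sum_insert, Finset.sum_insert, Finset.sum_insert,
      Finset.sum_singleton, if_pos (mem_col_x mm.1)] at h5
    · omega
    all_goals simp only [Finset.mem_insert, Finset.mem_singleton]; tauto
  have p1 := (P.pos r hr1).2
  have p2 := (P.pos r' hr1').2
  have p3 := (P.pos s hs1).2
  have p4 := (P.pos s' hs1').2
  have p5 := (P.pos m mm.1).2
  have hr2 : P.col a = {r', r} := by rw [hr, Finset.pair_comm]
  have hs2 : P.col b = {s', s} := by rw [hs, Finset.pair_comm]
  by_cases c1 : r ∈ P.col m.x <;> by_cases c2 : r' ∈ P.col m.x <;>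
    by_cases c3 : s ∈ P.col m.x <;> by_cases c4 : s' ∈ P.col m.x <;>
    simp only [c1, c2, c3, c4, if_true, if_false] at hcol <;>
    first
    | omega
    | exact hP.false_of_pinwheel ha hb hab hr hrr hs hss hm c1 c3 hcard
    | exact hP.false_of_pinwheel ha hb hab hr hrr hs2 hss.symm hm c1 c4 hcard
    | exact hP.false_of_pinwheel ha hb hab hr2 hrr.symm hs hss hm c2 c3 hcard
    | exact hP.false_of_pinwheel ha hb hab hr2 hrr.symm hs2 hss.symm hm c2 c4 hcard

lemma false_of_middle_card_eq_zero (hP : P.IsPerfect) (ha : a < n) (hb : b < n)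
    (hab : ∀ r ∈ P.col a, r ∉ P.col b) (h : (P.middle a b).card = 0) : False :=
  hP.false_of_sum_middle_const ha hb hab 0 fun j _ => by rw [Finset.card_eq_zero.1 h]; rfl

lemma not_mem_col_of_w_ne (hw : ∀ r ∈ P.rects, r.w ≠ n) :
    ∀ r ∈ P.col 0, r ∉ P.col (n - 1) := by
  intro r h1 h2
  rw [mem_col] at h1 h2
  have := hw r h1.1
  have := P.inside r h1.1
  omega

lemma false_of_card_of_w_ne (hP : P.IsPerfect) (hn : 0 < n) (hw : ∀ r ∈ P.rects, r.w ≠ n)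
    (hcard : P.rects.card = 2 ∨ P.rects.card = 3 ∨ P.rects.card = 5) : False := by
  have hab := not_mem_col_of_w_ne hw
  have hba : ∀ r ∈ P.col (n - 1), r ∉ P.col 0 := fun r h1 h2 => hab r h2 h1
  have ha : 0 < n := hn
  have hb : n - 1 < n := by omega
  have h1 := (P.col_nonempty ha).card_pos
  have h2 := (P.col_nonempty hb).card_pos
  have h3 := P.card_col_add_card_col_add_card_middle hab
  have hc := P.middle_comm 0 (n - 1)
  have z : (P.middle 0 (n - 1)).card ≠ 0 := hP.false_of_middle_card_eq_zero ha hb hab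
  have z11 : ¬ ((P.col 0).card = 1 ∧ (P.col (n - 1)).card = 1) := fun h =>
    hP.false_of_card_one_one ha hb hab h.1 h.2
  have z131 : ¬ ((P.col 0).card = 1 ∧ (P.col (n - 1)).card = 3 ∧
      (P.middle 0 (n - 1)).card = 1) := fun h =>
    hP.false_of_card_one_three_one ha hab h.1 h.2.1 h.2.2
  have z311 : ¬ ((P.col 0).card = 3 ∧ (P.col (n - 1)).card = 1 ∧
      (P.middle 0 (n - 1)).card = 1) := fun h =>
    hP.false_of_card_one_three_one hb hba h.2.1 h.1 (hc ▸ h.2.2)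
  have z122 : ¬ ((P.col 0).card = 1 ∧ (P.col (n - 1)).card = 2 ∧
      (P.middle 0 (n - 1)).card = 2) := fun h =>
    hP.false_of_card_one_two_two ha hb hab h.1 h.2.1 h.2.2
  have z212 : ¬ ((P.col 0).card = 2 ∧ (P.col (n - 1)).card = 1 ∧
      (P.middle 0 (n - 1)).card = 2) := fun h =>
    hP.false_of_card_one_two_two hb ha hba h.2.1 h.1 (hc ▸ h.2.2)
  have z221 : ¬ ((P.col 0).card = 2 ∧ (P.col (n - 1)).card = 2 ∧
      (P.middle 0 (n - 1)).card = 1 ∧ P.rects.card = 5) := fun h =>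
    hP.false_of_card_two_two_one ha hb hab h.1 h.2.1 h.2.2.1 h.2.2.2
  clear hP hw hab hba
  generalize (P.col 0).card = x at *
  generalize (P.col (n - 1)).card = y at *
  generalize (P.middle 0 (n - 1)).card = m at *
  generalize P.rects.card = k at *
  have hx : x ≤ 3 := by omega
  have hy : y ≤ 3 := by omega
  interval_cases x <;> interval_cases y <;> omega

lemma false_of_card_four (hP : P.IsPerfect) (hn : 0 < n) (hw : ∀ r ∈ P.rects, r.w ≠ n)
    (hh : ∀ r ∈ P.rects, r.h ≠ n) (hcard : P.rects.card = 4) : False := by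
  have hab := not_mem_col_of_w_ne hw
  have hb : n - 1 < n := by omega
  have two : ∀ i < n, 2 ≤ (P.col i).card := by
    intro i hi
    by_contra hlt
    have := (P.col_nonempty hi).card_pos
    obtain ⟨r, hr⟩ := Finset.card_eq_one.1 (by omega : (P.col i).card = 1)
    have h1 := P.sum_col hi
    rw [hr, Finset.sum_singleton] at h1
    exact hh r (mem_col.1 (by simp [hr] : r ∈ P.col i)).1 h1
  have h1 := two 0 hn
  have h2 := two _ hb
  have h3 := P.card_col_add_card_col_add_card_middle hab
  exact hP.false_of_middle_card_eq_zero hn hb hab (by omega)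

/-- If some width is not divisible by a divisor `p` of `n`, then at least three are not. -/
lemma three_le_card_filter_not_dvd_w (hP : P.IsPerfect) {p : ℕ} (hp : p ∣ n) {v : Rect}
    (hv : v ∈ P.rects) (hpv : ¬ p ∣ v.w) : 3 ≤ (P.rects.filter fun r => ¬ p ∣ r.w).card := by
  have key : ∀ r ∈ P.rects, ¬ p ∣ r.w → ∀ j < n, r ∈ P.row j →
      ∃ s ∈ P.rects, ¬ p ∣ s.w ∧ s ∈ P.row j ∧ s ≠ r := by
    intro r _ hpr j hj hrj
    by_contra! hcon
    refine hpr ?_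
    have h1 := P.sum_row hj
    rw [← Finset.add_sum_erase _ _ hrj] at h1
    refine (Nat.dvd_add_left ?_).1 (h1 ▸ hp)
    refine Finset.dvd_sum fun s hs => ?_
    rw [Finset.mem_erase] at hs
    by_contra hps
    exact hs.1 (hcon s (mem_row.1 hs.2).1 hps hs.2)
  obtain ⟨s, hs, hps, -, hsv⟩ := key v hv hpv v.y (y_lt hv) (mem_row_y hv)
  by_contra hlt
  have hsub : ({v, s} : Finset Rect) ⊆ P.rects.filter fun r => ¬ p ∣ r.w := by
    intro t ht
    simp only [Finset.mem_insert, Finset.mem_singleton] at ht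
    rcases ht with rfl | rfl <;> simp [*]
  have heq := Finset.eq_of_subset_of_card_le hsub (by rw [Finset.card_pair hsv.symm]; omega)
  have mem2 : ∀ t ∈ P.rects, ¬ p ∣ t.w → t = v ∨ t = s := by
    intro t ht hpt
    have : t ∈ P.rects.filter fun r => ¬ p ∣ r.w := by simp [ht, hpt]
    rw [← heq] at this
    simpa using this
  refine hsv (hP.eq_of_row_iff hs hv fun j hj => ⟨fun h => ?_, fun h => ?_⟩)
  · obtain ⟨t, ht, hpt, htj, hne⟩ := key s hs hps j hj h
    rcases mem2 t ht hpt with rfl | rfl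
    · exact htj
    · exact absurd rfl hne
  · obtain ⟨t, ht, hpt, htj, hne⟩ := key v hv hpv j hj h
    rcases mem2 t ht hpt with rfl | rfl
    · exact absurd rfl hne
    · exact htj

/-- There is no perfect partition into `2`, `3` or `5` rectangles in which some divisor `p` of `n`
divides exactly one side of every rectangle. -/
lemma false_of_card_of_dvd (hP : P.IsPerfect) (hn : 0 < n) {p : ℕ} (hp : p ∣ n)
    (hside : ∀ r ∈ P.rects, (p ∣ r.w ↔ ¬ p ∣ r.h))
    (hcard : P.rects.card = 2 ∨ P.rects.card = 3 ∨ P.rects.card = 5) : False := by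
  by_cases h1 : ∃ v ∈ P.rects, ¬ p ∣ v.w
  · by_cases h2 : ∃ v ∈ P.rects, ¬ p ∣ v.h
    · obtain ⟨v, hv, hpv⟩ := h1
      obtain ⟨u, hu, hpu⟩ := h2
      have c1 := hP.three_le_card_filter_not_dvd_w hp hv hpv
      have c2 := hP.transpose.three_le_card_filter_not_dvd_w hp (mem_transpose.2 hu) hpu
      have c3 := Finset.card_filter_add_card_filter_not (s := P.rects) (fun r => ¬ p ∣ r.w)
      have c4 : (P.transpose.rects.filter fun r => ¬ p ∣ r.w).card
          = (P.rects.filter fun r => ¬ ¬ p ∣ r.w).card := by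
        rw [← Finset.card_image_of_injective _ Rect.transpose_injective]
        congr 1
        ext r
        rw [← Rect.transpose_transpose r, Rect.transpose_injective.mem_finset_image,
          Finset.mem_filter, Finset.mem_filter, mem_transpose]
        refine and_congr_right fun h => ?_
        show ¬ p ∣ r.h ↔ ¬ ¬ p ∣ r.w
        rw [hside r h, not_not]
      omega
    · push Not at h2
      refine hP.false_of_card_of_w_ne hn (fun r hr h => ?_) hcard
      exact (hside r hr).1 (h ▸ hp) (h2 r hr)
  · push Not at h1
    refine hP.transpose.false_of_card_of_w_ne hn (fun r' hr' h => ?_)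
      (by rwa [card_transpose])
    obtain ⟨r, hr, rfl⟩ := Finset.mem_image.1 hr'
    exact (hside r hr).1 (h1 r hr) (by rw [show r.h = n from h]; exact hp)

end IsPerfect

end Mondrian

namespace DimSearch

/-- The binary number whose set bits are the sums of `f` over the sets that contain at most one
member of each of the given lists. -/
def mask (f : ℕ × ℕ → ℕ) : List (List (ℕ × ℕ)) → ℕ
  | [] => 1
  | o :: t => o.foldr (fun d m => m ||| (mask f t <<< f d)) (mask f t)

lemma testBit_foldr_left (f : ℕ × ℕ → ℕ) (m i : ℕ) (h : m.testBit i) (o : List (ℕ × ℕ)) :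
    (o.foldr (fun d m' => m' ||| (m <<< f d)) m).testBit i := by
  induction o with
  | nil => exact h
  | cons d o ih => simp [ih]

lemma testBit_foldr_right (f : ℕ × ℕ → ℕ) (m i : ℕ) (h : m.testBit i) {o : List (ℕ × ℕ)}
    {d : ℕ × ℕ} (hd : d ∈ o) :
    (o.foldr (fun d m' => m' ||| (m <<< f d)) m).testBit (f d + i) := by
  induction o with
  | nil => simp at hd
  | cons e o ih =>
    rcases List.mem_cons.1 hd with rfl | hd
    · simp [h]
    · simp [ih hd]

lemma testBit_mask (f : ℕ × ℕ → ℕ) (items : List (List (ℕ × ℕ))) (S : Finset (ℕ × ℕ))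
    (hS : ∀ d ∈ S, ∃ o ∈ items, d ∈ o)
    (huniq : ∀ o ∈ items, ∀ d ∈ S, ∀ e ∈ S, d ∈ o → e ∈ o → d = e) :
    (mask f items).testBit (∑ d ∈ S, f d) := by
  induction items generalizing S with
  | nil =>
    have : S = ∅ := Finset.eq_empty_of_forall_notMem fun d hd => by simpa using hS d hd
    simp [this, mask]
  | cons o t ih =>
    by_cases h : ∃ d ∈ S, d ∈ o
    · obtain ⟨d, hd, hdo⟩ := h
      rw [← Finset.add_sum_erase _ _ hd]
      refine testBit_foldr_right f _ _ (ih _ (fun e he => ?_) fun o' ho' a ha b hb => ?_) hdo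
      · rw [Finset.mem_erase] at he
        obtain ⟨o', ho', heo'⟩ := hS e he.2
        rcases List.mem_cons.1 ho' with rfl | ho'
        · exact absurd (huniq _ List.mem_cons_self e he.2 d hd heo' hdo) he.1
        · exact ⟨o', ho', heo'⟩
      · exact huniq o' (List.mem_cons_of_mem _ ho') a (Finset.mem_of_mem_erase ha) b
          (Finset.mem_of_mem_erase hb)
    · push Not at h
      refine testBit_foldr_left f _ _ (ih _ (fun e he => ?_) fun o' ho' => ?_) o
      · obtain ⟨o', ho', heo'⟩ := hS e he
        rcases List.mem_cons.1 ho' with rfl | ho'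
        · exact absurd heo' (h e he)
        · exact ⟨o', ho', heo'⟩
      · exact huniq o' (List.mem_cons_of_mem _ ho')

/-- A set of dimensions satisfies the sum conditions imposed by the rows (or columns) of a tiling
of the `n × n` square by rectangles with these dimensions. -/
def Feasible (n : ℕ) (f g : ℕ × ℕ → ℕ) (D : Finset (ℕ × ℕ)) : Prop :=
  (∀ d ∈ D, ∃ S ⊆ D.erase d, f d + ∑ e ∈ S, f e = n) ∧
  ∀ d ∈ D, ∀ e ∈ D, d ≠ e → n < f d + f e →
    ∃ S ⊆ (D.erase d).erase e, g d + g e + ∑ x ∈ S, g x = n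

/-- The bitmask of the sums over sets consisting of members of `chosen` satisfying `p` and of at
most one orientation of each member of `todo`. -/
def completions (f : ℕ × ℕ → ℕ) (p : ℕ × ℕ → Bool) (chosen todo : List (ℕ × ℕ)) : ℕ :=
  mask f (((chosen.filter p).map fun e => [e]) ++ todo.map fun e => [e, e.swap])

/-- Whether the sum of `f` through each chosen member can still be completed to `n`, and the sum of
`g` through any two members that do not fit side by side. -/
def check (n : ℕ) (f g : ℕ × ℕ → ℕ) (chosen todo : List (ℕ × ℕ)) : Bool :=
  chosen.all fun d => (completions f (fun e => e != d) chosen todo).testBit (n - f d) &&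
    chosen.all fun e => d == e || Nat.ble (f d + f e) n || (Nat.ble (g d + g e) n &&
      (completions g (fun x => x != d && x != e) chosen todo).testBit (n - (g d + g e)))

/-- Exhaustive search for a set of dimensions that contains `chosen` and one orientation of all
but `skips` members of the list. -/
def search (n : ℕ) : ℕ → List (ℕ × ℕ) → List (ℕ × ℕ) → Bool
  | _, chosen, [] => check n Prod.fst Prod.snd chosen [] && check n Prod.snd Prod.fst chosen []
  | skips, chosen, d :: t =>
      check n Prod.fst Prod.snd chosen (d :: t) && check n Prod.snd Prod.fst chosen (d :: t) &&
      (search n skips (d :: chosen) t || search n skips (d.swap :: chosen) t ||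
        (Nat.blt 0 skips && search n (skips - 1) chosen t))

variable {n : ℕ} {D : Finset (ℕ × ℕ)}

lemma testBit_completions {f : ℕ × ℕ → ℕ} {p : ℕ × ℕ → Bool}
    (hswap : ∀ d ∈ D, d.swap ∈ D → d.swap = d) {chosen todo : List (ℕ × ℕ)}
    (hcov : ∀ d ∈ D, d ∈ chosen ∨ d ∈ todo ∨ d.swap ∈ todo) {S : Finset (ℕ × ℕ)}
    (hSD : ∀ e ∈ S, e ∈ D) (hp : ∀ e ∈ S, p e = true) :
    (completions f p chosen todo).testBit (∑ e ∈ S, f e) = true := by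
  refine testBit_mask f _ S (fun e he => ?_) fun o ho a ha b hb hao hbo => ?_
  · have hep := hp e he
    rcases hcov e (hSD e he) with h | h | h
    · exact ⟨[e], by simp [h, hep], by simp⟩
    · exact ⟨[e, e.swap], List.mem_append_right _ (List.mem_map.2 ⟨e, h, rfl⟩), by simp⟩
    · exact ⟨[e.swap, e], List.mem_append_right _ (List.mem_map.2 ⟨e.swap, h, by simp⟩), by simp⟩
  · rcases List.mem_append.1 ho with ho | ho <;> obtain ⟨x, -, rfl⟩ := List.mem_map.1 ho
    · rw [List.mem_singleton] at hao hbo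
      rw [hao, hbo]
    · simp only [List.mem_cons, List.not_mem_nil, or_false] at hao hbo
      rcases hao with rfl | rfl <;> rcases hbo with rfl | rfl
      · rfl
      · exact (hswap a (hSD a ha) (hSD _ hb)).symm
      · exact hswap b (hSD b hb) (hSD _ ha)
      · rfl

lemma check_eq_true {f g : ℕ × ℕ → ℕ} (hD : Feasible n f g D)
    (hswap : ∀ d ∈ D, d.swap ∈ D → d.swap = d) {chosen todo : List (ℕ × ℕ)}
    (hc : ∀ d ∈ chosen, d ∈ D) (hcov : ∀ d ∈ D, d ∈ chosen ∨ d ∈ todo ∨ d.swap ∈ todo) :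
    check n f g chosen todo = true := by
  refine List.all_eq_true.2 fun d hd => Bool.and_eq_true_iff.2 ⟨?_, ?_⟩
  · obtain ⟨S, hS, hsum⟩ := hD.1 d (hc d hd)
    have : n - f d = ∑ e ∈ S, f e := by omega
    rw [this]
    exact testBit_completions hswap hcov (fun e he => Finset.mem_of_mem_erase (hS he))
      fun e he => by simpa using Finset.ne_of_mem_erase (hS he)
  refine List.all_eq_true.2 fun e he => ?_
  by_cases hde : d = e
  · simp [hde]
  by_cases hle : f d + f e ≤ n
  · simp [hle]
  obtain ⟨S, hS, hsum⟩ := hD.2 d (hc d hd) e (hc e he) hde (by omega)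
  have hsub : n - (g d + g e) = ∑ x ∈ S, g x := by omega
  have : g d + g e ≤ n := by omega
  rw [hsub]
  simp only [Bool.or_eq_true, Bool.and_eq_true, Nat.ble_eq, this, true_and]
  refine Or.inr (testBit_completions hswap hcov (fun x hx => ?_) fun x hx => ?_)
  · exact Finset.mem_of_mem_erase (Finset.mem_of_mem_erase (hS hx))
  · have := hS hx
    simp only [Finset.mem_erase] at this
    simp [this]

lemma search_eq_true (hfst : Feasible n Prod.fst Prod.snd D) (hsnd : Feasible n Prod.snd Prod.fst D)
    (hswap : ∀ d ∈ D, d.swap ∈ D → d.swap = d) (todo : List (ℕ × ℕ)) :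
    ∀ (skips : ℕ) (chosen : List (ℕ × ℕ)), (∀ d ∈ chosen, d ∈ D) →
      (∀ d ∈ D, d ∈ chosen ∨ d ∈ todo ∨ d.swap ∈ todo) →
      todo.countP (fun d => d ∉ D ∧ d.swap ∉ D) ≤ skips → search n skips chosen todo = true := by
  induction todo with
  | nil =>
    intro _ chosen hc hcov _
    simp only [search, check_eq_true hfst hswap hc hcov, check_eq_true hsnd hswap hc hcov,
      Bool.and_self]
  | cons e t ih =>
    intro skips chosen hc hcov hcount
    rw [search, check_eq_true hfst hswap hc hcov, check_eq_true hsnd hswap hc hcov]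
    rw [List.countP_cons] at hcount
    by_cases c1 : e ∈ D
    · rw [ih skips (e :: chosen)]
      · rfl
      · simpa [c1] using hc
      · intro d hd
        rcases hcov d hd with h | h | h
        · exact Or.inl (List.mem_cons_of_mem _ h)
        · rcases List.mem_cons.1 h with rfl | h
          · exact Or.inl List.mem_cons_self
          · exact Or.inr (Or.inl h)
        · rcases List.mem_cons.1 h with h | h
          · refine Or.inl (List.mem_cons.2 (Or.inl ?_))
            rw [← hswap d hd (h ▸ c1), h]
          · exact Or.inr (Or.inr h)
      · omega
    by_cases c2 : e.swap ∈ D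
    · rw [ih skips (e.swap :: chosen)]
      · simp
      · simpa [c2] using hc
      · intro d hd
        rcases hcov d hd with h | h | h
        · exact Or.inl (List.mem_cons_of_mem _ h)
        · rcases List.mem_cons.1 h with rfl | h
          · exact absurd hd c1
          · exact Or.inr (Or.inl h)
        · rcases List.mem_cons.1 h with h | h
          · refine Or.inl (List.mem_cons.2 (Or.inl ?_))
            rw [← h, Prod.swap_swap]
          · exact Or.inr (Or.inr h)
      · omega
    simp only [c1, c2, not_false_eq_true, and_self, decide_true, if_true] at hcount
    rw [ih (skips - 1) chosen hc]
    · simp only [Nat.blt_eq, Bool.and_true, Bool.or_eq_true, Bool.true_and]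
      right
      omega
    · intro d hd
      rcases hcov d hd with h | h | h
      · exact Or.inl h
      · rcases List.mem_cons.1 h with rfl | h
        · exact absurd hd c1
        · exact Or.inr (Or.inl h)
      · rcases List.mem_cons.1 h with h | h
        · exact absurd (by rwa [← h, Prod.swap_swap]) c2
        · exact Or.inr (Or.inr h)
    · omega

lemma card_le_countP (hswap : ∀ d ∈ D, d.swap ∈ D → d.swap = d) {R : List (ℕ × ℕ)}
    (hcov : ∀ d ∈ D, d ∈ R ∨ d.swap ∈ R) :
    D.card ≤ R.countP (fun d => ¬ (d ∉ D ∧ d.swap ∉ D)) := by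
  rw [List.countP_eq_length_filter]
  refine le_trans ?_ (List.toFinset_card_le _)
  refine Finset.card_le_card_of_injOn (fun d => if d ∈ R then d else d.swap) ?_ ?_
  · intro d hd
    have hd : d ∈ D := hd
    simp only [Finset.mem_coe, List.mem_toFinset, List.mem_filter, decide_eq_true_eq]
    split_ifs with h
    · exact ⟨h, by tauto⟩
    · exact ⟨(hcov d hd).resolve_left h, by rw [Prod.swap_swap]; tauto⟩
  · intro d hd e he h
    have hd : d ∈ D := hd
    have he : e ∈ D := he
    simp only at h
    split_ifs at h
    · exact h
    · rw [h]
      exact hswap e he (h ▸ hd)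
    · rw [← h]
      exact (hswap d hd (h ▸ he)).symm
    · exact Prod.swap_injective h

lemma search_eq_true_of_card (hfst : Feasible n Prod.fst Prod.snd D)
    (hsnd : Feasible n Prod.snd Prod.fst D) (hswap : ∀ d ∈ D, d.swap ∈ D → d.swap = d)
    {R : List (ℕ × ℕ)} (hcov : ∀ d ∈ D, d ∈ R ∨ d.swap ∈ R) :
    search n (R.length - D.card) [] R = true := by
  refine search_eq_true hfst hsnd hswap R _ _ (by simp) (fun d hd => Or.inr (hcov d hd)) ?_
  have h1 := card_le_countP hswap hcov
  have h2 := List.length_eq_countP_add_countP (fun d => decide (d ∉ D ∧ d.swap ∉ D)) (l := R)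
  simp only [decide_eq_true_eq] at h2
  omega

/-- The numbers `q ^ i * r ^ j * s ^ l` with `i ≤ x`, `j ≤ y` and `l ≤ z`. -/
def monomials (x y z q r s : ℕ) : List ℕ :=
  (List.range (x + 1) ×ˢ List.range (y + 1) ×ˢ List.range (z + 1)).map fun t =>
    q ^ t.1 * r ^ t.2.1 * s ^ t.2.2

/-- The pairs with product `A` and first entry from `L` that fit into the `n × n` square. -/
def candidates (n A : ℕ) (L : List ℕ) : List (ℕ × ℕ) :=
  (L.filter fun e => Nat.ble A (n * e) && Nat.ble e n).map fun e => (e, A / e)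

/-- Whether the search excludes every set of `k` dimensions from the list. -/
def refutes (n k : ℕ) (R : List (ℕ × ℕ)) : Bool :=
  Nat.blt R.length k ||
    !search n (R.length - k) [] (R.insertionSort fun d e => max e.1 e.2 ≤ max d.1 d.2)

end DimSearch

namespace Mondrian

variable {n : ℕ}

/-- The dimensions of the rectangles in a partition. -/
def dims (P : Mondrian n) : Finset (ℕ × ℕ) := P.rects.image fun r => (r.w, r.h)

namespace IsPerfect

open DimSearch

variable {P : Mondrian n}

lemma dims_injOn (hP : P.IsPerfect) :
    Set.InjOn (fun r : Rect => (r.w, r.h)) (P.rects : Set Rect) :=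
  fun _ hr _ hs h => hP.eq_of_w_eq hr hs (congrArg Prod.fst h)

lemma card_dims (hP : P.IsPerfect) : P.dims.card = P.rects.card :=
  Finset.card_image_of_injOn hP.dims_injOn

lemma swap_eq_of_mem_dims (hP : P.IsPerfect) {d : ℕ × ℕ} (hd : d ∈ P.dims)
    (hd' : d.swap ∈ P.dims) : d.swap = d := by
  obtain ⟨r, hr, rfl⟩ := Finset.mem_image.1 hd
  obtain ⟨s, hs, h⟩ := Finset.mem_image.1 hd'
  have := hP.eq_of_w_eq_h hs hr (congrArg Prod.fst h)
  rw [← h, this]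

lemma exists_sum_dims_erase (hP : P.IsPerfect) (f : ℕ × ℕ → ℕ) {T : Finset Rect}
    (hT : T ⊆ P.rects) (hsum : ∑ r ∈ T, f (r.w, r.h) = n) {r : Rect} (hr : r ∈ T) :
    ∃ S ⊆ P.dims.erase (r.w, r.h), f (r.w, r.h) + ∑ e ∈ S, f e = n := by
  refine ⟨(T.erase r).image fun t => (t.w, t.h), fun e he => ?_, ?_⟩
  · obtain ⟨t, ht, rfl⟩ := Finset.mem_image.1 he
    rw [Finset.mem_erase] at ht
    exact Finset.mem_erase.2 ⟨fun h => ht.1 (hP.dims_injOn (hT ht.2) (hT hr) h),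
      Finset.mem_image_of_mem _ (hT ht.2)⟩
  · rw [Finset.sum_image (hP.dims_injOn.mono fun t ht => hT (Finset.mem_of_mem_erase ht)),
      Finset.add_sum_erase T (fun t => f (t.w, t.h)) hr, hsum]

lemma exists_sum_dims_erase_erase (hP : P.IsPerfect) (f : ℕ × ℕ → ℕ) {T : Finset Rect}
    (hT : T ⊆ P.rects) (hsum : ∑ r ∈ T, f (r.w, r.h) = n) {r s : Rect} (hr : r ∈ T) (hs : s ∈ T)
    (hrs : r ≠ s) :
    ∃ S ⊆ (P.dims.erase (r.w, r.h)).erase (s.w, s.h),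
      f (r.w, r.h) + f (s.w, s.h) + ∑ e ∈ S, f e = n := by
  refine ⟨((T.erase r).erase s).image fun t => (t.w, t.h), fun e he => ?_, ?_⟩
  · obtain ⟨t, ht, rfl⟩ := Finset.mem_image.1 he
    rw [Finset.mem_erase, Finset.mem_erase] at ht
    exact Finset.mem_erase.2 ⟨fun h => ht.1 (hP.dims_injOn (hT ht.2.2) (hT hs) h),
      Finset.mem_erase.2 ⟨fun h => ht.2.1 (hP.dims_injOn (hT ht.2.2) (hT hr) h),
        Finset.mem_image_of_mem _ (hT ht.2.2)⟩⟩
  · rw [Finset.sum_image (hP.dims_injOn.mono fun t ht =>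
        hT (Finset.mem_of_mem_erase (Finset.mem_of_mem_erase ht))), add_assoc,
      Finset.add_sum_erase (T.erase r) (fun t => f (t.w, t.h))
        (Finset.mem_erase.2 ⟨hrs.symm, hs⟩),
      Finset.add_sum_erase T (fun t => f (t.w, t.h)) hr, hsum]

lemma feasible_fst_snd (hP : P.IsPerfect) : Feasible n Prod.fst Prod.snd P.dims := by
  constructor
  · intro d hd
    obtain ⟨r, hr, rfl⟩ := Finset.mem_image.1 hd
    exact hP.exists_sum_dims_erase Prod.fst (row_subset P r.y) (P.sum_row (y_lt hr)) (mem_row_y hr)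
  · intro d hd e he hde hlt
    obtain ⟨r, hr, rfl⟩ := Finset.mem_image.1 hd
    obtain ⟨s, hs, rfl⟩ := Finset.mem_image.1 he
    have h1 := P.inside r hr
    have h2 := P.inside s hs
    have h3 := P.pos r hr
    have h4 := P.pos s hs
    simp only at hlt
    exact hP.exists_sum_dims_erase_erase Prod.snd (col_subset P (max r.x s.x))
      (P.sum_col (by omega)) (mem_col.2 ⟨hr, by omega, by omega⟩)
      (mem_col.2 ⟨hs, by omega, by omega⟩) fun h => hde (h ▸ rfl)

lemma feasible_snd_fst (hP : P.IsPerfect) : Feasible n Prod.snd Prod.fst P.dims := by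
  constructor
  · intro d hd
    obtain ⟨r, hr, rfl⟩ := Finset.mem_image.1 hd
    exact hP.exists_sum_dims_erase Prod.snd (col_subset P r.x) (P.sum_col (x_lt hr)) (mem_col_x hr)
  · intro d hd e he hde hlt
    obtain ⟨r, hr, rfl⟩ := Finset.mem_image.1 hd
    obtain ⟨s, hs, rfl⟩ := Finset.mem_image.1 he
    have h1 := P.inside r hr
    have h2 := P.inside s hs
    have h3 := P.pos r hr
    have h4 := P.pos s hs
    simp only at hlt
    exact hP.exists_sum_dims_erase_erase Prod.fst (row_subset P (max r.y s.y))
      (P.sum_row (by omega)) (mem_row.2 ⟨hr, by omega, by omega⟩)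
      (mem_row.2 ⟨hs, by omega, by omega⟩) fun h => hde (h ▸ rfl)

/-- The search never excludes the dimensions of an actual perfect partition. -/
lemma false_of_refutes (hP : P.IsPerfect) {A : ℕ} (hA : ∀ r ∈ P.rects, r.area = A) {L : List ℕ}
    (hL : ∀ r ∈ P.rects, r.w ∈ L ∨ r.h ∈ L)
    (h : refutes n P.rects.card (candidates n A L) = true) : False := by
  have hcov : ∀ d ∈ P.dims, d ∈ candidates n A L ∨ d.swap ∈ candidates n A L := by
    intro d hd
    obtain ⟨r, hr, rfl⟩ := Finset.mem_image.1 hd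
    have h1 := P.pos r hr
    have h2 := P.inside r hr
    have h3 := hA r hr
    rw [Rect.area] at h3
    refine (hL r hr).imp (fun h => ?_) fun h => ?_
    · refine List.mem_map.2 ⟨r.w, List.mem_filter.2 ⟨h, ?_⟩, ?_⟩
      · simp only [Bool.and_eq_true, Nat.ble_eq]
        exact ⟨h3 ▸ (mul_comm r.w r.h ▸ Nat.mul_le_mul_right _ (by omega)), by omega⟩
      · rw [← h3, Nat.mul_div_cancel_left _ h1.1]
    · refine List.mem_map.2 ⟨r.h, List.mem_filter.2 ⟨h, ?_⟩, ?_⟩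
      · simp only [Bool.and_eq_true, Nat.ble_eq]
        exact ⟨h3 ▸ Nat.mul_le_mul_right _ (by omega), by omega⟩
      · rw [← h3, Nat.mul_div_cancel _ h1.2]
        rfl
  set R := (candidates n A L).insertionSort fun d e => max e.1 e.2 ≤ max d.1 d.2 with hR
  have hmem : ∀ d, d ∈ R ↔ d ∈ candidates n A L := fun d => List.mem_insertionSort _
  have hlen : R.length = (candidates n A L).length := List.length_insertionSort _ _
  have hcov' : ∀ d ∈ P.dims, d ∈ R ∨ d.swap ∈ R := fun d hd => by
    rw [hmem, hmem]
    exact hcov d hd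
  have hsearch := search_eq_true_of_card hP.feasible_fst_snd hP.feasible_snd_fst
    (fun d hd hd' => hP.swap_eq_of_mem_dims hd hd') hcov'
  have hcard := (card_le_countP (fun d hd hd' => hP.swap_eq_of_mem_dims hd hd') hcov').trans
    List.countP_le_length
  rw [hP.card_dims, hlen] at hsearch hcard
  rw [refutes, ← hR, hsearch] at h
  simp only [Bool.not_true, Bool.or_false, Nat.blt_eq] at h
  omega

end IsPerfect

end Mondrian

namespace DimSearch

/-- A number without proper prime factors up to `13`. -/
def Rough (m : ℕ) : Prop := ∀ d ∈ [2, 3, 5, 7, 11, 13], d ∣ m → m ≤ d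

instance : DecidablePred Rough := fun m => inferInstanceAs (Decidable (∀ d ∈ _, d ∣ m → m ≤ d))

lemma refutes_seven : ∀ q ∈ List.range 8, 2 ≤ q → q ≠ 7 → Rough q →
    ∀ r ∈ List.range (7 * q + 1), q < r → r ≠ 7 → Rough r →
    ∀ s ∈ List.range (7 * r + 1), r < s → s ≠ 7 → Rough s →
    refutes (7 * (q * r * s)) 7 (candidates (7 * (q * r * s)) (7 * (q * r * s) ^ 2)
      (monomials 2 2 2 q r s)) = true := by
  decide +kernel

lemma refutes_eleven : ∀ q ∈ List.range 12, 2 ≤ q → q ≠ 11 → Rough q →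
    ∀ r ∈ List.range 12, q < r → r ≠ 11 → Rough r →
    ∀ s ∈ List.range (11 * r + 1), r < s → s ≠ 11 → Rough s →
    refutes (11 * (q * r * s)) 11 (candidates (11 * (q * r * s)) (11 * (q * r * s) ^ 2)
      (monomials 2 2 2 q r s)) = true := by
  decide +kernel

lemma refutes_thirteen : ∀ q ∈ List.range 14, 2 ≤ q → q ≠ 13 → Rough q →
    ∀ r ∈ List.range 14, q < r → r ≠ 13 → Rough r →
    ∀ s ∈ List.range (13 * r + 1), r < s → s ≠ 13 → Rough s →
    refutes (13 * (q * r * s)) 13 (candidates (13 * (q * r * s)) (13 * (q * r * s) ^ 2)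
      (monomials 2 2 2 q r s)) = true := by
  decide +kernel

lemma refutes_two_mul : ∀ p ∈ [3, 5, 7], ∀ q ∈ List.range (2 * p + 1), 2 < q → q ≠ p → Rough q →
    ∀ r ∈ List.range (2 * p * q + 1), q < r → r ≠ p → Rough r →
    refutes (2 * p * (q * r)) (2 * p) (candidates (2 * p * (q * r)) (2 * p * (q * r) ^ 2)
      (monomials 2 2 1 q r 2)) = true := by
  decide +kernel

end DimSearch

/-- The exponent triples `(i, j, l)` for which `i a + j b + l c` exceeds the corresponding sum for
`t` by at least zero and at most `P`. -/
def InWindow (a b c P : ℝ) (t : ℕ × ℕ × ℕ) (i j l : ℕ) : Prop :=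
  t.1 * a + t.2.1 * b + t.2.2 * c ≤ i * a + j * b + l * c ∧
    i * a + j * b + l * c ≤ P + (t.1 * a + t.2.1 * b + t.2.2 * c)

section Windows

variable {a b c P : ℝ} {i j l : ℕ}

lemma window_two (ha : 0 < a) (hab : a < b) (hi : i ≤ 2) (hj : j ≤ 2) (hl : l ≤ 0)
    (h : InWindow a b c P (1, 1, 0) i j l) :
    (i, j, l) ∈ ({(1, 1, 0), (2, 1, 0), (0, 2, 0), (1, 2, 0), (2, 2, 0)} : Finset _) := by
  obtain ⟨h1, h2⟩ := h
  interval_cases i <;> interval_cases j <;> interval_cases l <;>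
    first | decide | (exfalso; norm_num at h1 h2; linarith)

lemma window_three (ha : 0 < a) (hab : a < b) (hbc : b < c) (hi : i ≤ 2) (hj : j ≤ 2)
    (hl : l ≤ 2) (h : InWindow a b c P (1, 1, 1) i j l) :
    (i, j, l) ∈ ({(2, 2, 0), (1, 1, 1), (2, 1, 1), (0, 2, 1), (1, 2, 1), (2, 2, 1),
      (0, 0, 2), (1, 0, 2), (2, 0, 2), (0, 1, 2), (1, 1, 2), (2, 1, 2), (0, 2, 2), (1, 2, 2),
      (2, 2, 2)} : Finset _) := by
  obtain ⟨h1, h2⟩ := h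
  interval_cases i <;> interval_cases j <;> interval_cases l <;>
    first | decide | (exfalso; norm_num at h1 h2; linarith)

lemma window_three_of_lt_first (ha : 0 < a) (hab : a < b) (hbc : b < c) (hP : P < a)
    (hi : i ≤ 2) (hj : j ≤ 2) (hl : l ≤ 2) (h : InWindow a b c P (1, 1, 1) i j l) :
    (i, j, l) ∈ ({(2, 2, 0), (1, 1, 1), (0, 2, 1), (0, 0, 2), (1, 0, 2), (0, 1, 2)} :
      Finset _) := by
  obtain ⟨h1, h2⟩ := h
  interval_cases i <;> interval_cases j <;> interval_cases l <;>
    first | decide | (exfalso; norm_num at h1 h2; linarith)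

lemma window_three_of_lt_second (ha : 0 < a) (hab : a < b) (hbc : b < c) (hP : P < b)
    (hi : i ≤ 2) (hj : j ≤ 2) (hl : l ≤ 2) (h : InWindow a b c P (1, 1, 1) i j l) :
    (i, j, l) ∈ ({(2, 2, 0), (1, 1, 1), (2, 1, 1), (0, 2, 1), (0, 0, 2), (1, 0, 2), (2, 0, 2),
      (0, 1, 2)} : Finset _) := by
  obtain ⟨h1, h2⟩ := h
  interval_cases i <;> interval_cases j <;> interval_cases l <;>
    first | decide | (exfalso; norm_num at h1 h2; linarith)

lemma window_three_of_first_add_lt_second (ha : 0 < a) (hab : a < b) (hbc : b < c)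
    (hP : P + a < b) (hi : i ≤ 2) (hj : j ≤ 2) (hl : l ≤ 2)
    (h : InWindow a b c P (1, 1, 1) i j l) :
    (i, j, l) ∈ ({(2, 2, 0), (1, 1, 1), (2, 1, 1), (0, 0, 2), (1, 0, 2), (2, 0, 2)} :
      Finset _) := by
  obtain ⟨h1, h2⟩ := h
  interval_cases i <;> interval_cases j <;> interval_cases l <;>
    first | decide | (exfalso; norm_num at h1 h2; linarith)

lemma window_three_of_second_add_lt_third (ha : 0 < a) (hab : a < b) (haP : a ≤ P)
    (hP : P + b < c) (hi : i ≤ 2) (hj : j ≤ 2) (hl : l ≤ 2)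
    (h : InWindow a b c P (1, 1, 1) i j l) :
    (i, j, l) ∈ ({(1, 1, 1), (2, 1, 1), (0, 2, 1), (1, 2, 1), (2, 2, 1), (0, 0, 2)} :
      Finset _) := by
  obtain ⟨h1, h2⟩ := h
  interval_cases i <;> interval_cases j <;> interval_cases l <;>
    first | decide | (exfalso; norm_num at h1 h2; linarith)

lemma window_one_extra (ha : 0 < a) (hi : i ≤ 2) (hj : j ≤ 0) (hl : l ≤ 1)
    (h : InWindow a b c P (1, 0, 0) i j l) :
    (i, j, l) ∈ ({(1, 0, 0), (2, 0, 0), (0, 0, 1), (1, 0, 1), (2, 0, 1)} : Finset _) := by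
  obtain ⟨h1, h2⟩ := h
  interval_cases i <;> interval_cases j <;> interval_cases l <;>
    first | decide | (exfalso; norm_num at h1 h2; linarith)

lemma window_two_extra (ha : 0 < a) (hab : a < b) (hi : i ≤ 2) (hj : j ≤ 2) (hl : l ≤ 1)
    (h : InWindow a b c P (1, 1, 0) i j l) :
    (i, j, l) ∈ ({(1, 1, 0), (2, 1, 0), (0, 2, 0), (1, 2, 0), (2, 2, 0), (0, 0, 1), (1, 0, 1),
      (2, 0, 1), (0, 1, 1), (1, 1, 1), (2, 1, 1), (0, 2, 1), (1, 2, 1), (2, 2, 1)} :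
      Finset _) := by
  obtain ⟨h1, h2⟩ := h
  interval_cases i <;> interval_cases j <;> interval_cases l <;>
    first | decide | (exfalso; norm_num at h1 h2; linarith)

lemma window_two_extra_of_lt_first (hab : a < b) (hc : 0 < c) (hcP : c < P) (hP : P < a)
    (hi : i ≤ 2) (hj : j ≤ 2) (hl : l ≤ 1) (h : InWindow a b c P (1, 1, 0) i j l) :
    (i, j, l) ∈ ({(1, 1, 0), (0, 2, 0), (1, 1, 1), (0, 2, 1), (2, 0, 1)} : Finset _) := by
  obtain ⟨h1, h2⟩ := h
  interval_cases i <;> interval_cases j <;> interval_cases l <;>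
    first | decide | (exfalso; norm_num at h1 h2; linarith)

lemma window_two_extra_of_first_add_lt_second (ha : 0 < a) (hc : 0 < c) (hcP : c < P)
    (hP : P + a < b) (hi : i ≤ 2) (hj : j ≤ 2) (hl : l ≤ 1)
    (h : InWindow a b c P (1, 1, 0) i j l) :
    (i, j, l) ∈ ({(1, 1, 0), (2, 1, 0), (1, 1, 1), (2, 1, 1), (0, 1, 1)} : Finset _) := by
  obtain ⟨h1, h2⟩ := h
  interval_cases i <;> interval_cases j <;> interval_cases l <;>
    first | decide | (exfalso; norm_num at h1 h2; linarith)

end Windows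

lemma exists_exponents_of_dvd {q r s x y z e : ℕ} (hq : q.Prime) (hr : r.Prime) (hs : s.Prime)
    (h : e ∣ q ^ x * r ^ y * s ^ z) :
    ∃ i j l, i ≤ x ∧ j ≤ y ∧ l ≤ z ∧ e = q ^ i * r ^ j * s ^ l := by
  obtain ⟨u, v, hu, hv, rfl⟩ := (Nat.dvd_mul).1 h
  obtain ⟨a, w, ha, hw, rfl⟩ := (Nat.dvd_mul).1 hu
  obtain ⟨i, hi, rfl⟩ := (Nat.dvd_prime_pow hq).1 ha
  obtain ⟨j, hj, rfl⟩ := (Nat.dvd_prime_pow hr).1 hw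
  obtain ⟨l, hl, rfl⟩ := (Nat.dvd_prime_pow hs).1 hv
  exact ⟨i, j, l, hi, hj, hl, rfl⟩

lemma log_monomial {q r s : ℕ} (hq : 0 < q) (hr : 0 < r) (hs : 0 < s) (i j l : ℕ) :
    Real.log ((q ^ i * r ^ j * s ^ l : ℕ) : ℝ)
      = i * Real.log q + j * Real.log r + l * Real.log s := by
  have hq' : (q : ℝ) ≠ 0 := by positivity
  have hr' : (r : ℝ) ≠ 0 := by positivity
  have hs' : (s : ℝ) ≠ 0 := by positivity
  push_cast
  rw [Real.log_mul (by positivity) (by positivity), Real.log_mul (by positivity) (by positivity),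
    Real.log_pow, Real.log_pow, Real.log_pow]

lemma inWindow_log {q r s k : ℕ} (hq : 0 < q) (hr : 0 < r) (hs : 0 < s) (hk : 0 < k)
    {t : ℕ × ℕ × ℕ} {i j l : ℕ}
    (h1 : q ^ t.1 * r ^ t.2.1 * s ^ t.2.2 ≤ q ^ i * r ^ j * s ^ l)
    (h2 : q ^ i * r ^ j * s ^ l ≤ k * (q ^ t.1 * r ^ t.2.1 * s ^ t.2.2)) :
    InWindow (Real.log q) (Real.log r) (Real.log s) (Real.log k) t i j l := by
  have pos : ∀ i j l : ℕ, 0 < q ^ i * r ^ j * s ^ l := fun i j l => by positivity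
  constructor
  · rw [← log_monomial hq hr hs, ← log_monomial hq hr hs]
    exact Real.log_le_log (by exact_mod_cast pos _ _ _) (by exact_mod_cast h1)
  · rw [← log_monomial hq hr hs, ← log_monomial hq hr hs, ← Real.log_mul (by positivity)
      (by exact_mod_cast (pos _ _ _).ne')]
    exact Real.log_le_log (by exact_mod_cast pos _ _ _) (by exact_mod_cast h2)

namespace Mondrian

variable {n : ℕ}

/-- Every rectangle has a side that divides `D` and lies between `m` and `N`. -/
def HasSides (P : Mondrian n) (D m N : ℕ) : Prop :=
  ∀ r ∈ P.rects, ∃ e, (r.w = e ∨ r.h = e) ∧ e ∣ D ∧ m ≤ e ∧ e ≤ N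

namespace IsPerfect

open DimSearch

variable {P : Mondrian n}

lemma card_le_of_side_mem (hP : P.IsPerfect) {T : Finset ℕ}
    (hT : ∀ r ∈ P.rects, ∃ e ∈ T, r.w = e ∨ r.h = e) : P.rects.card ≤ T.card := by
  choose! φ hφ hside using hT
  refine Finset.card_le_card_of_injOn φ hφ fun r hr s hs h => ?_
  rcases hside r hr with h1 | h1 <;> rcases hside s hs with h2 | h2
  · exact hP.eq_of_w_eq hr hs (by rw [h1, h2, h])
  · exact hP.eq_of_w_eq_h hr hs (by rw [h1, h2, h])
  · exact (hP.eq_of_w_eq_h hs hr (by rw [h1, h2, h])).symm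
  · exact hP.eq_of_h_eq hr hs (by rw [h1, h2, h])

lemma card_le_of_window (hP : P.IsPerfect) {q r s x y z k m : ℕ} (hq : q.Prime) (hr : r.Prime)
    (hs : s.Prime) (hk : 0 < k) (t : ℕ × ℕ × ℕ) (hm : m = q ^ t.1 * r ^ t.2.1 * s ^ t.2.2)
    (hS : P.HasSides (q ^ x * r ^ y * s ^ z) m (k * m)) (E : Finset (ℕ × ℕ × ℕ))
    (hE : ∀ i j l, i ≤ x → j ≤ y → l ≤ z →
      InWindow (Real.log q) (Real.log r) (Real.log s) (Real.log k) t i j l → (i, j, l) ∈ E) :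
    P.rects.card ≤ E.card := by
  refine le_trans (hP.card_le_of_side_mem
    (T := E.image fun t => q ^ t.1 * r ^ t.2.1 * s ^ t.2.2) fun v hv => ?_) Finset.card_image_le
  obtain ⟨e, he, hdvd, h1, h2⟩ := hS v hv
  obtain ⟨i, j, l, hi, hj, hl, rfl⟩ := exists_exponents_of_dvd hq hr hs hdvd
  subst hm
  exact ⟨_, Finset.mem_image.2 ⟨(i, j, l),
    hE i j l hi hj hl (inWindow_log hq.pos hr.pos hs.pos hk h1 h2), rfl⟩, he⟩

lemma false_of_hasSides_of_refutes (hP : P.IsPerfect) {q r s x y z m N A : ℕ} (hq : q.Prime)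
    (hr : r.Prime) (hs : s.Prime) (hS : P.HasSides (q ^ x * r ^ y * s ^ z) m N)
    (hA : ∀ r ∈ P.rects, r.area = A)
    (h : refutes n P.rects.card (candidates n A (monomials x y z q r s)) = true) : False := by
  refine hP.false_of_refutes hA (fun v hv => ?_) h
  obtain ⟨e, he, hdvd, -, -⟩ := hS v hv
  obtain ⟨i, j, l, hi, hj, hl, rfl⟩ := exists_exponents_of_dvd hq hr hs hdvd
  have hmem : q ^ i * r ^ j * s ^ l ∈ monomials x y z q r s :=
    List.mem_map.2 ⟨(i, j, l), by simp [hi, hj, hl], rfl⟩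
  exact he.imp (fun h' => by rwa [h']) fun h' => by rwa [h']

end IsPerfect

end Mondrian

lemma Nat.Prime.rough {m : ℕ} (hm : m.Prime) : DimSearch.Rough m := by
  intro d hd h
  refine ((Nat.dvd_prime hm).1 h).elim (fun h1 => ?_) fun h => h.ge
  simp [h1] at hd

lemma log_cast_lt {a b : ℕ} (ha : 0 < a) (h : a < b) : Real.log a < Real.log b :=
  Real.log_lt_log (by exact_mod_cast ha) (by exact_mod_cast h)

lemma log_cast_add_lt {a b c : ℕ} (ha : 0 < a) (hb : 0 < b) (h : a * b < c) :
    Real.log a + Real.log b < Real.log c := by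
  rw [← Real.log_mul (by positivity) (by positivity)]
  exact_mod_cast log_cast_lt (Nat.mul_pos ha hb) h

namespace Mondrian.IsPerfect

open DimSearch

variable {n : ℕ} {P : Mondrian n}

/-- Bounds on the prime factors when the sides are composed of three primes. -/
lemma bounds_of_three (hP : P.IsPerfect) {q r s k : ℕ} (hq : q.Prime) (hr : r.Prime)
    (hs : s.Prime) (hqr : q < r) (hrs : r < s) (hk : 0 < k)
    (hS : P.HasSides (q ^ 2 * r ^ 2 * s ^ 2) (q * r * s) (k * (q * r * s))) :
    P.rects.card ≤ 15 ∧ (7 ≤ P.rects.card → q ≤ k ∧ r ≤ k * q ∧ s ≤ k * r) ∧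
      (9 ≤ P.rects.card → r ≤ k) := by
  have la := hq.log_pos
  have lb := log_cast_lt hq.pos hqr
  have lc := log_cast_lt hr.pos hrs
  have key := hP.card_le_of_window hq hr hs hk (1, 1, 1) (by ring) hS
  have c1 : 7 ≤ P.rects.card → q ≤ k := fun h => by
    by_contra! hlt
    exact absurd ((key _ fun i j l hi hj hl => window_three_of_lt_first la lb lc
      (log_cast_lt hk hlt) hi hj hl).trans Finset.card_le_six) (by omega)
  refine ⟨(key _ fun i j l => window_three la lb lc).trans (by decide),
    fun h => ⟨c1 h, ?_, ?_⟩, fun h => ?_⟩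
  · by_contra! hlt
    exact absurd ((key _ fun i j l hi hj hl => window_three_of_first_add_lt_second la lb lc
      (log_cast_add_lt hk hq.pos hlt) hi hj hl).trans Finset.card_le_six) (by omega)
  · by_contra! hlt
    exact absurd ((key _ fun i j l hi hj hl => window_three_of_second_add_lt_third la lb
      (Real.log_le_log (by exact_mod_cast hq.pos) (by exact_mod_cast c1 h))
      (log_cast_add_lt hk hr.pos hlt) hi hj hl).trans Finset.card_le_six) (by omega)
  · by_contra! hlt
    have h8 := (key _ fun i j l hi hj hl => window_three_of_lt_second la lb lc
      (log_cast_lt hk hlt) hi hj hl).trans (by decide : _ ≤ 8)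
    omega

lemma card_le_five_of_two (hP : P.IsPerfect) {q r k : ℕ} (hq : q.Prime) (hr : r.Prime)
    (hqr : q < r) (hk : 0 < k) (hS : P.HasSides (q ^ 2 * r ^ 2) (q * r) (k * (q * r))) :
    P.rects.card ≤ 5 := by
  have hS' : P.HasSides (q ^ 2 * r ^ 2 * 2 ^ 0) (q * r) (k * (q * r)) := by simpa using hS
  exact (hP.card_le_of_window hq hr Nat.prime_two hk (1, 1, 0) (by ring) hS' _
    fun i j l => window_two hq.log_pos (log_cast_lt hq.pos hqr)).trans Finset.card_le_five

lemma card_le_five_of_one_extra (hP : P.IsPerfect) {q p k : ℕ} (hq : q.Prime) (hp : p.Prime)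
    (hk : 0 < k) (hS : P.HasSides (p * q ^ 2) q (k * q)) : P.rects.card ≤ 5 := by
  have hS' : P.HasSides (q ^ 2 * 2 ^ 0 * p ^ 1) q (k * q) := by
    convert hS using 1
    ring
  exact (hP.card_le_of_window hq Nat.prime_two hp hk (1, 0, 0) (by ring) hS' _
    fun i j l => window_one_extra hq.log_pos).trans Finset.card_le_five

/-- Bounds on the prime factors when the sides are composed of two primes and an extra factor. -/
lemma bounds_of_two_extra (hP : P.IsPerfect) {q r p k : ℕ} (hq : q.Prime) (hr : r.Prime)
    (hp : p.Prime) (hqr : q < r) (hpk : p < k)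
    (hS : P.HasSides (p * (q * r) ^ 2) (q * r) (k * (q * r))) :
    P.rects.card ≤ 14 ∧ (6 ≤ P.rects.card → q ≤ k ∧ r ≤ k * q) := by
  have hS' : P.HasSides (q ^ 2 * r ^ 2 * p ^ 1) (q * r) (k * (q * r)) := by
    convert hS using 1
    ring
  have hk : 0 < k := by omega
  have la := hq.log_pos
  have lb := log_cast_lt hq.pos hqr
  have lp := hp.log_pos
  have lpk := log_cast_lt hp.pos hpk
  have key := hP.card_le_of_window hq hr hp hk (1, 1, 0) (by ring) hS'
  refine ⟨(key _ fun i j l => window_two_extra la lb).trans (by decide), fun h => ⟨?_, ?_⟩⟩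
  · by_contra! hlt
    exact absurd ((key _ fun i j l hi hj hl => window_two_extra_of_lt_first lb lp lpk
      (log_cast_lt hk hlt) hi hj hl).trans Finset.card_le_five) (by omega)
  · by_contra! hlt
    exact absurd ((key _ fun i j l hi hj hl => window_two_extra_of_first_add_lt_second la lp lpk
      (log_cast_add_lt hk hq.pos hlt) hi hj hl).trans Finset.card_le_five) (by omega)

end Mondrian.IsPerfect

lemma exists_eq_mul_sq_of_mul_eq_sq {n k A : ℕ} (hn : n ≠ 0) (h : k * A = n ^ 2) :
    ∃ a b c, k = a * b ^ 2 ∧ A = a * c ^ 2 ∧ n = a * b * c := by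
  obtain ⟨a, b, rfl, ha⟩ := Nat.sq_mul_squarefree k
  obtain ⟨a', c, rfl, ha'⟩ := Nat.sq_mul_squarefree A
  have hne : b ^ 2 * a * (c ^ 2 * a') ≠ 0 := h ▸ pow_ne_zero 2 hn
  have hbc : b * c ∣ n := (Nat.pow_dvd_pow_iff two_ne_zero).1 ⟨a * a', by rw [← h]; ring⟩
  obtain ⟨m, rfl⟩ := hbc
  have hbc0 : 0 < (b * c) ^ 2 := pow_pos (Nat.pos_of_ne_zero (left_ne_zero_of_mul hn)) 2
  have hm : a * a' = m ^ 2 := Nat.eq_of_mul_eq_mul_left hbc0 (by rw [← mul_pow, ← h]; ring)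
  have ham : a ∣ m := (ha.dvd_pow_iff_dvd two_ne_zero).1 ⟨a', hm.symm⟩
  obtain ⟨t, rfl⟩ := ham
  have ha0 : 0 < a := Nat.pos_of_ne_zero ha.ne_zero
  have hat : a' = a * (t * t) := Nat.eq_of_mul_eq_mul_left ha0 (by rw [hm]; ring)
  have ht : t = 1 := Nat.isUnit_iff.1 (ha' t ⟨a, by rw [hat]; ring⟩)
  subst ht
  rw [mul_one, mul_one] at hat
  subst hat
  exact ⟨a', b, c, by ring, by ring, by ring⟩

lemma Squarefree.factorization_eq_one {m p : ℕ} (hm : Squarefree m) (hp : p ∈ m.primeFactors) :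
    m.factorization p = 1 :=
  le_antisymm (hm.natFactorization_le_one p)
    ((Nat.prime_of_mem_primeFactors hp).factorization_pos_of_dvd hm.ne_zero
      (Nat.dvd_of_mem_primeFactors hp))

lemma card_divisors_of_squarefree {m : ℕ} (hm : Squarefree m) :
    m.divisors.card = 2 ^ m.primeFactors.card := by
  rw [Nat.card_divisors hm.ne_zero, ← Finset.prod_const]
  refine Finset.prod_congr rfl fun p hp => ?_
  rw [hm.factorization_eq_one hp]

lemma card_divisors_sq_of_squarefree {m : ℕ} (hm : Squarefree m) :
    (m ^ 2).divisors.card = 3 ^ m.primeFactors.card := by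
  rw [Nat.card_divisors (pow_ne_zero 2 hm.ne_zero), Nat.primeFactors_pow _ two_ne_zero,
    ← Finset.prod_const]
  refine Finset.prod_congr rfl fun p hp => ?_
  simp [hm.factorization_eq_one hp]

/-- The product of the first `j` primes, for small `j`. -/
def smallPrimorial : ℕ → ℕ
  | 0 => 1
  | 1 => 2
  | 2 => 6
  | 3 => 30
  | 4 => 210
  | _ => 0

lemma lt_of_card_primesBelow_lt {S : Finset ℕ} (hS : ∀ p ∈ S, p.Prime) {j : ℕ}
    (h : (j.primesBelow).card < S.card) : ∃ p ∈ S, j ≤ p := by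
  by_contra! hlt
  exact absurd (Finset.card_le_card fun p hp => Nat.mem_primesBelow.2 ⟨hlt p hp, hS p hp⟩)
    (by omega)

lemma smallPrimorial_le_prod (j : ℕ) (S : Finset ℕ) (hS : ∀ p ∈ S, p.Prime) (hj : S.card = j) :
    smallPrimorial j ≤ ∏ p ∈ S, p := by
  have step : ∀ (i b B : ℕ), (∀ T : Finset ℕ, (∀ p ∈ T, p.Prime) → T.card = i → B ≤ ∏ p ∈ T, p) →
      b.primesBelow.card ≤ i → ∀ T : Finset ℕ, (∀ p ∈ T, p.Prime) → T.card = i + 1 →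
      b * B ≤ ∏ p ∈ T, p := by
    intro i b B hB hb T hT hcard
    obtain ⟨p, hp, hbp⟩ := lt_of_card_primesBelow_lt hT (by omega : b.primesBelow.card < T.card)
    rw [← Finset.mul_prod_erase T _ hp]
    refine Nat.mul_le_mul hbp (hB _ (fun q hq => hT q (Finset.mem_of_mem_erase hq)) ?_)
    rw [Finset.card_erase_of_mem hp, hcard]
    rfl
  have h0 : ∀ T : Finset ℕ, (∀ p ∈ T, p.Prime) → T.card = 0 → 1 ≤ ∏ p ∈ T, p := by
    intro T _ hT
    rw [Finset.card_eq_zero.1 hT]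
    simp
  have h1 := step 0 2 1 h0 (by decide)
  have h2 := step 1 3 2 h1 (by decide)
  have h3 := step 2 5 6 h2 (by decide)
  have h4 := step 3 7 30 h3 (by decide)
  match j with
  | 0 => exact h0 S hS hj
  | 1 => exact h1 S hS hj
  | 2 => exact h2 S hS hj
  | 3 => exact h3 S hS hj
  | 4 => exact h4 S hS hj
  | _ + 5 => exact Nat.zero_le _

lemma smallPrimorial_le {m : ℕ} (hm : Squarefree m) :
    smallPrimorial m.primeFactors.card ≤ m := by
  conv_rhs => rw [← Nat.prod_primeFactors_of_squarefree hm]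
  exact smallPrimorial_le_prod _ _ (fun p hp => Nat.prime_of_mem_primeFactors hp) rfl

lemma exists_prime_of_card_primeFactors {m : ℕ} (hm : Squarefree m)
    (h : m.primeFactors.card = 1) : m.Prime := by
  obtain ⟨p, hp⟩ := Finset.card_eq_one.1 h
  rw [← Nat.prod_primeFactors_of_squarefree hm, hp, Finset.prod_singleton]
  exact Nat.prime_of_mem_primeFactors (hp ▸ Finset.mem_singleton_self p)

lemma exists_two_primes_of_card_primeFactors {m : ℕ} (hm : Squarefree m)
    (h : m.primeFactors.card = 2) : ∃ q r, q.Prime ∧ r.Prime ∧ q < r ∧ m = q * r := by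
  obtain ⟨q, r, hne, heq⟩ := Finset.card_eq_two.1 h
  have hprod := Nat.prod_primeFactors_of_squarefree hm
  rw [heq, Finset.prod_pair hne] at hprod
  have hq := Nat.prime_of_mem_primeFactors (heq ▸ by simp : q ∈ m.primeFactors)
  have hr := Nat.prime_of_mem_primeFactors (heq ▸ by simp : r ∈ m.primeFactors)
  rcases lt_or_gt_of_ne hne with hlt | hlt
  · exact ⟨q, r, hq, hr, hlt, hprod.symm⟩
  · exact ⟨r, q, hr, hq, hlt, by rw [← hprod, mul_comm]⟩

lemma exists_three_primes_of_card_primeFactors {m : ℕ} (hm : Squarefree m)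
    (h : m.primeFactors.card = 3) :
    ∃ q r s, q.Prime ∧ r.Prime ∧ s.Prime ∧ q < r ∧ r < s ∧ m = q * r * s := by
  obtain ⟨q, r, s, h1, h2, h3, heq⟩ := Finset.card_eq_three.1 h
  have hprod := Nat.prod_primeFactors_of_squarefree hm
  rw [heq, Finset.prod_insert (by simp [h1, h2]), Finset.prod_pair h3] at hprod
  have hq := Nat.prime_of_mem_primeFactors (heq ▸ by simp : q ∈ m.primeFactors)
  have hr := Nat.prime_of_mem_primeFactors (heq ▸ by simp : r ∈ m.primeFactors)
  have hs := Nat.prime_of_mem_primeFactors (heq ▸ by simp : s ∈ m.primeFactors)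
  rcases lt_or_gt_of_ne h1 with c1 | c1 <;> rcases lt_or_gt_of_ne h2 with c2 | c2 <;>
    rcases lt_or_gt_of_ne h3 with c3 | c3
  · exact ⟨q, r, s, hq, hr, hs, c1, c3, by rw [← hprod]; ring⟩
  · exact ⟨q, s, r, hq, hs, hr, c2, c3, by rw [← hprod]; ring⟩
  · omega
  · exact ⟨s, q, r, hs, hq, hr, c2, c1, by rw [← hprod]; ring⟩
  · exact ⟨r, q, s, hr, hq, hs, c1, c2, by rw [← hprod]; ring⟩
  · omega
  · exact ⟨r, s, q, hr, hs, hq, c3, c2, by rw [← hprod]; ring⟩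
  · exact ⟨s, r, q, hs, hr, hq, c3, c1, by rw [← hprod]; ring⟩

namespace Mondrian

variable {n : ℕ} {P : Mondrian n}

/-- If the prime `p` divides the area `p * d` just once, it divides exactly one side. -/
lemma dvd_w_iff_not_dvd_h {p d : ℕ} (hp : p.Prime) (hd : ¬ p ∣ d)
    (hA : ∀ r ∈ P.rects, r.area = p * d) {r : Rect} (hr : r ∈ P.rects) :
    p ∣ r.w ↔ ¬ p ∣ r.h := by
  have h := hA r hr
  rw [Rect.area] at h
  constructor
  · rintro ⟨u, hu⟩ ⟨v, hv⟩
    refine hd ⟨u * v, Nat.eq_of_mul_eq_mul_left hp.pos ?_⟩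
    rw [← h, hu, hv]
    ring
  · exact fun h' => ((hp.dvd_mul).1 (h ▸ dvd_mul_right p d)).resolve_right h'

lemma exists_side_dvd_of_prime {p d : ℕ} (hp : p.Prime) (hd : ¬ p ∣ d)
    (hA : ∀ r ∈ P.rects, r.area = p * d) {r : Rect} (hr : r ∈ P.rects) :
    ∃ e f, (r.w = e ∨ r.h = e) ∧ (r.w = f ∨ r.h = f) ∧ e * f = p * d ∧ e ∣ d := by
  have hiff := dvd_w_iff_not_dvd_h hp hd hA hr
  have h := hA r hr
  rw [Rect.area] at h
  by_cases hw : p ∣ r.w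
  · refine ⟨r.h, r.w, Or.inr rfl, Or.inl rfl, by rw [mul_comm, h], ?_⟩
    exact (((Nat.Prime.coprime_iff_not_dvd hp).2 (hiff.1 hw)).symm).dvd_of_dvd_mul_left
      (h ▸ dvd_mul_left r.h r.w)
  · refine ⟨r.w, r.h, Or.inl rfl, Or.inr rfl, h, ?_⟩
    exact (((Nat.Prime.coprime_iff_not_dvd hp).2 hw).symm).dvd_of_dvd_mul_left
      (h ▸ dvd_mul_right r.w r.h)

lemma side_pos_and_le {r : Rect} (hr : r ∈ P.rects) {e : ℕ} (he : r.w = e ∨ r.h = e) :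
    0 < e ∧ e ≤ n := by
  have := P.pos r hr
  have := P.inside r hr
  omega

lemma hasSides_of_prime {p a c : ℕ} (hp : p.Prime) (hd : ¬ p ∣ a * c ^ 2)
    (hA : ∀ r ∈ P.rects, r.area = p * (a * c ^ 2)) (hn : n = p * a * c) :
    P.HasSides (a * c ^ 2) c (p * a * c) := by
  intro r hr
  obtain ⟨e, f, he, hf, hef, hdvd⟩ := exists_side_dvd_of_prime hp hd hA hr
  refine ⟨e, he, hdvd, ?_, hn ▸ (side_pos_and_le hr he).2⟩
  have hfn := (side_pos_and_le hr hf).2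
  have hpos : 0 < p * a * c := by
    have := side_pos_and_le hr hf
    omega
  refine Nat.le_of_mul_le_mul_left ?_ hpos
  calc p * a * c * c = e * f := by rw [hef]; ring
    _ ≤ e * n := Nat.mul_le_mul_left _ hfn
    _ = p * a * c * e := by rw [hn]; ring

lemma hasSides_of_sq {b c : ℕ} (hA : ∀ r ∈ P.rects, r.area = c ^ 2) (hn : n = b * c) :
    P.HasSides (c ^ 2) c (b * c) := by
  intro r hr
  have h := hA r hr
  rw [Rect.area] at h
  rcases le_total r.w r.h with hle | hle
  · exact ⟨r.h, Or.inr rfl, h ▸ dvd_mul_left _ _, by nlinarith, hn ▸ (side_pos_and_le hr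
      (Or.inr rfl)).2⟩
  · exact ⟨r.w, Or.inl rfl, h ▸ dvd_mul_right _ _, by nlinarith, hn ▸ (side_pos_and_le hr
      (Or.inl rfl)).2⟩

lemma IsPerfect.card_le_card_divisors (hP : P.IsPerfect) {D : ℕ} (hD : D ≠ 0)
    (h : ∀ r ∈ P.rects, ∃ e, (r.w = e ∨ r.h = e) ∧ e ∣ D) : P.rects.card ≤ D.divisors.card := by
  refine hP.card_le_of_side_mem fun r hr => ?_
  obtain ⟨e, he, hdvd⟩ := h r hr
  exact ⟨e, Nat.mem_divisors.2 ⟨hdvd, hD⟩, he⟩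

end Mondrian

lemma card_primeFactors_mul_of_coprime {a b : ℕ} (h : a.Coprime b) :
    (a * b).primeFactors.card = a.primeFactors.card + b.primeFactors.card := by
  rw [h.primeFactors_mul, Finset.card_union_of_disjoint h.disjoint_primeFactors]

namespace Mondrian.IsPerfect

open DimSearch

variable {n : ℕ} {P : Mondrian n}

lemma false_of_card_sq (hP : P.IsPerfect) {b c : ℕ} (hb : 2 ≤ b) (hn : n = b * c)
    (hsq : Squarefree n) (hcard : P.rects.card = b ^ 2) (hA : ∀ r ∈ P.rects, r.area = c ^ 2)
    (h2 : 2 ≤ n.primeFactors.card) (h4 : n.primeFactors.card ≤ 4) : False := by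
  subst hn
  have hcop := Nat.coprime_of_squarefree_mul hsq
  have hsb := hsq.of_mul_left
  have hsc := hsq.of_mul_right
  have hS := hasSides_of_sq hA rfl
  have hcount := hP.card_le_card_divisors (pow_ne_zero 2 hsc.ne_zero) fun r hr => by
    obtain ⟨e, he, hdvd, -⟩ := hS r hr
    exact ⟨e, he, hdvd⟩
  rw [card_divisors_sq_of_squarefree hsc, hcard] at hcount
  have hfb := smallPrimorial_le hsb
  have hb2 : b * smallPrimorial b.primeFactors.card ≤ 3 ^ c.primeFactors.card :=
    (Nat.mul_le_mul_left b hfb).trans (by rwa [← sq])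
  have hb2' := (Nat.mul_le_mul_right (smallPrimorial b.primeFactors.card) hfb).trans hb2
  have hb2'' : 4 ≤ 3 ^ c.primeFactors.card := le_trans (by nlinarith) hcount
  rw [card_primeFactors_mul_of_coprime hcop] at h2 h4
  have hz : b.primeFactors.card ≠ 0 := fun h => by
    rw [Finset.card_eq_zero, Nat.primeFactors_eq_empty] at h
    omega
  have hcase : b.primeFactors.card = 1 ∧ (c.primeFactors.card = 2 ∨ c.primeFactors.card = 3) := by
    generalize b.primeFactors.card = z at *
    generalize c.primeFactors.card = u at *
    have : z ≤ 4 := by omega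
    have : u ≤ 4 := by omega
    interval_cases z <;> interval_cases u <;> simp [smallPrimorial] at *
  have hbp := exists_prime_of_card_primeFactors hsb hcase.1
  rcases hb.eq_or_lt with rfl | hb3
  · have hodd : ∀ r ∈ P.rects, ∀ x, x ∣ r.area → x ≠ 2 * c := by
      rintro r hr x hx rfl
      rw [hA r hr] at hx
      have := Nat.prime_two.dvd_of_dvd_pow ((dvd_mul_right 2 c).trans hx)
      exact (Nat.Prime.coprime_iff_not_dvd Nat.prime_two).1 hcop this
    exact hP.false_of_card_four (Nat.pos_of_ne_zero hsq.ne_zero)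
      (fun r hr => hodd r hr _ (dvd_mul_right _ _)) (fun r hr => hodd r hr _ (dvd_mul_left _ _))
      hcard
  · have h9 : 9 ≤ P.rects.card := by
      rw [hcard]
      nlinarith
    rcases hcase.2 with hu | hu
    · obtain ⟨q, r, hq, hr, hqr, rfl⟩ := exists_two_primes_of_card_primeFactors hsc hu
      have := hP.card_le_five_of_two (k := b) hq hr hqr (by omega) (by rwa [mul_pow] at hS)
      omega
    · obtain ⟨q, r, s, hq, hr, hs, hqr, hrs, rfl⟩ :=
        exists_three_primes_of_card_primeFactors hsc hu
      obtain ⟨h15, -, hrb⟩ := hP.bounds_of_three (k := b) hq hr hs hqr hrs (by omega)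
        (by rwa [mul_pow, mul_pow] at hS)
      have hrb := hrb h9
      have hb4 : b < 4 := by nlinarith
      have hr3 : r = b := by
        have := hq.two_le
        omega
      subst hr3
      exact (Nat.Prime.coprime_iff_not_dvd hr).1 hcop ⟨q * s, by ring⟩

lemma false_of_card_prime (hP : P.IsPerfect) {p c : ℕ} (hp : p.Prime) (hn : n = p * c)
    (hsq : Squarefree n) (hcard : P.rects.card = p) (hA : ∀ r ∈ P.rects, r.area = p * c ^ 2)
    (hc : c.primeFactors.card ≤ 3) : False := by
  subst hn
  have hcop := Nat.coprime_of_squarefree_mul hsq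
  have hpc := (Nat.Prime.coprime_iff_not_dvd hp).1 hcop
  have hpc2 : ¬ p ∣ c ^ 2 := fun h => hpc (hp.dvd_of_dvd_pow h)
  have hsc := hsq.of_mul_right
  by_cases hp5 : p = 2 ∨ p = 3 ∨ p = 5
  · exact hP.false_of_card_of_dvd (Nat.pos_of_ne_zero hsq.ne_zero) (dvd_mul_right p c)
      (fun r hr => dvd_w_iff_not_dvd_h hp hpc2 hA hr) (by rwa [hcard])
  have hp7 : 7 ≤ p := by
    have h2 := hp.two_le
    by_contra! h
    interval_cases p <;> first | omega | (norm_num at hp)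
  have hS : P.HasSides (c ^ 2) c (p * c) := by
    simpa using hasSides_of_prime (a := 1) hp (by simpa using hpc2) (by simpa using hA) (by simp)
  by_cases hc1 : c.primeFactors.card ≤ 1
  · have hcount := hP.card_le_card_divisors (pow_ne_zero 2 hsc.ne_zero) fun r hr => by
      obtain ⟨e, he, hdvd, -⟩ := hS r hr
      exact ⟨e, he, hdvd⟩
    rw [card_divisors_sq_of_squarefree hsc, hcard] at hcount
    have : 3 ^ c.primeFactors.card ≤ 3 ^ 1 := Nat.pow_le_pow_right (by norm_num) hc1
    omega
  rcases (by omega : c.primeFactors.card = 2 ∨ c.primeFactors.card = 3) with hu | hu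
  · obtain ⟨q, r, hq, hr, hqr, rfl⟩ := exists_two_primes_of_card_primeFactors hsc hu
    have := hP.card_le_five_of_two hq hr hqr hp.pos (by rwa [mul_pow] at hS)
    omega
  obtain ⟨q, r, s, hq, hr, hs, hqr, hrs, rfl⟩ := exists_three_primes_of_card_primeFactors hsc hu
  rw [mul_pow, mul_pow] at hS
  obtain ⟨h15, h7, h9⟩ := hP.bounds_of_three hq hr hs hqr hrs hp.pos hS
  rw [hcard] at h15 h7 h9
  obtain ⟨hqp, hrp, hsp⟩ := h7 hp7
  have nq : q ≠ p := fun h => hpc ⟨r * s, by rw [h]; ring⟩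
  have nr : r ≠ p := fun h => hpc ⟨q * s, by rw [h]; ring⟩
  have ns : s ≠ p := fun h => hpc ⟨q * r, by rw [h]; ring⟩
  refine hP.false_of_hasSides_of_refutes hq hr hs hS hA ?_
  rw [hcard]
  have hcases : p = 7 ∨ p = 11 ∨ p = 13 := by
    interval_cases p <;> first | omega | (norm_num at hp)
  rcases hcases with rfl | rfl | rfl
  · exact refutes_seven q (List.mem_range.2 (by omega)) hq.two_le nq hq.rough
      r (List.mem_range.2 (by omega)) hqr nr hr.rough s (List.mem_range.2 (by omega)) hrs ns hs.rough
  · have := h9 (by norm_num)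
    exact refutes_eleven q (List.mem_range.2 (by omega)) hq.two_le nq hq.rough
      r (List.mem_range.2 (by omega)) hqr nr hr.rough s (List.mem_range.2 (by omega)) hrs ns hs.rough
  · have := h9 (by norm_num)
    exact refutes_thirteen q (List.mem_range.2 (by omega)) hq.two_le nq hq.rough
      r (List.mem_range.2 (by omega)) hqr nr hr.rough s (List.mem_range.2 (by omega)) hrs ns hs.rough

lemma false_of_card_two_primes (hP : P.IsPerfect) {p p' c : ℕ} (hp : p.Prime) (hp' : p'.Prime)
    (hlt : p' < p) (hn : n = p * p' * c) (hsq : Squarefree n) (hcard : P.rects.card = p * p')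
    (hA : ∀ r ∈ P.rects, r.area = p * (p' * c ^ 2))
    (hc : c.primeFactors.card = 1 ∨ c.primeFactors.card = 2) : False := by
  have h2 := hp'.two_le
  have hk6 : 6 ≤ p * p' := by nlinarith
  subst hn
  have hsc := hsq.of_mul_right
  have hcop := Nat.coprime_of_squarefree_mul hsq
  have hpc : ¬ p ∣ c := (Nat.Prime.coprime_iff_not_dvd hp).1 hcop.coprime_mul_right
  have hpc' : ¬ p' ∣ c := (Nat.Prime.coprime_iff_not_dvd hp').1 hcop.coprime_mul_left
  have hd : ¬ p ∣ p' * c ^ 2 := fun h => by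
    rcases (hp.dvd_mul).1 h with h | h
    · exact absurd (Nat.le_of_dvd hp'.pos h) (by omega)
    · exact hpc (hp.dvd_of_dvd_pow h)
  have hS := hasSides_of_prime hp hd hA rfl
  rcases hc with hc | hc
  · have hq := exists_prime_of_card_primeFactors hsc hc
    have := hP.card_le_five_of_one_extra hq hp' (by omega) hS
    omega
  obtain ⟨q, r, hq, hr, hqr, rfl⟩ := exists_two_primes_of_card_primeFactors hsc hc
  obtain ⟨h14, h6⟩ := hP.bounds_of_two_extra hq hr hp' hqr (by nlinarith : p' < p * p') hS
  rw [hcard] at h14 h6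
  obtain ⟨hqk, hrk⟩ := h6 hk6
  obtain rfl : p' = 2 := by
    by_contra hne
    have : 3 ≤ p' := by omega
    have : p ≠ 4 := fun h => by
      rw [h] at hp
      norm_num at hp
    have : 5 ≤ p := by omega
    nlinarith
  have hp357 : p ∈ [3, 5, 7] := by
    have : p ≤ 7 := by omega
    interval_cases p <;> first | decide | (norm_num at hp)
  have hq2 : q ≠ 2 := fun h => hpc' ⟨r, by rw [h]⟩
  have hqp : q ≠ p := fun h => hpc ⟨r, by rw [h]⟩
  have hrp : r ≠ p := fun h => hpc ⟨q, by rw [h, mul_comm]⟩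
  have hS' : P.HasSides (q ^ 2 * r ^ 2 * 2 ^ 1) (q * r) (p * 2 * (q * r)) := by
    convert hS using 1
    ring
  refine hP.false_of_hasSides_of_refutes hq hr Nat.prime_two hS' hA ?_
  have := refutes_two_mul p hp357 q (List.mem_range.2 (by omega))
    (lt_of_le_of_ne hq.two_le hq2.symm) hqp hq.rough r
    (List.mem_range.2 (by rw [mul_comm 2 p]; omega)) hqr hrp hr.rough
  rw [mul_comm 2 p] at this
  rwa [hcard, ← mul_assoc p 2]

end Mondrian.IsPerfect

/-- If `n` is a product of `2`, `3`, or `4` pairwise distinct primes, then the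
`n × n` square has no perfect Mondrian partition. -/
theorem no_perfect_of_squarefree (n : ℕ) (h₁ : Squarefree n)
    (h₂ : 2 ≤ n.primeFactors.card) (h₃ : n.primeFactors.card ≤ 4) :
    ¬ ∃ P : Mondrian n, 2 ≤ P.rects.card ∧ P.IsPerfect := by
  rintro ⟨P, hk, hP⟩
  obtain ⟨r₀, hr₀⟩ : P.rects.Nonempty := Finset.card_pos.1 (by omega)
  obtain ⟨a, b, c, hcard, hA, hn⟩ := exists_eq_mul_sq_of_mul_eq_sq h₁.ne_zero (hP.card_mul hr₀)
  replace hA : ∀ r ∈ P.rects, r.area = a * c ^ 2 := fun r hr => (hP r hr r₀ hr₀).trans hA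
  rcases eq_or_ne a 1 with rfl | ha
  · rw [one_mul] at hcard hn
    refine hP.false_of_card_sq ?_ hn h₁ hcard (by simpa using hA) h₂ h₃
    by_contra! h
    interval_cases b <;> omega
  obtain ⟨p, hp, a', rfl⟩ := Nat.exists_prime_and_dvd ha
  have hsq : Squarefree (p * a' * b * c) := hn ▸ h₁
  have hcop_c := Nat.coprime_of_squarefree_mul hsq
  have hsc := hsq.of_mul_right
  have hsab := hsq.of_mul_left
  have hcop_b := Nat.coprime_of_squarefree_mul hsab
  have hsb := hsab.of_mul_right
  have hsa := hsab.of_mul_left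
  have hcop_p := Nat.coprime_of_squarefree_mul hsa
  have hsa' := hsa.of_mul_right
  have hcop_pc : p.Coprime c := hcop_c.coprime_mul_right.coprime_mul_right
  have hcop_ac : a'.Coprime (c ^ 2) := (hcop_c.coprime_mul_right.coprime_mul_left).pow_right 2
  have hd : ¬ p ∣ a' * c ^ 2 := (Nat.Prime.coprime_iff_not_dvd hp).1
    (hcop_p.mul_right (hcop_pc.pow_right 2))
  have hd0 : a' * c ^ 2 ≠ 0 := mul_ne_zero hsa'.ne_zero (pow_ne_zero 2 hsc.ne_zero)
  have hA' : ∀ r ∈ P.rects, r.area = p * (a' * c ^ 2) := fun r hr => by rw [hA r hr, mul_assoc]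
  have hcount := hP.card_le_card_divisors hd0 fun r hr => by
    obtain ⟨e, -, he, -, -, hdvd⟩ := Mondrian.exists_side_dvd_of_prime hp hd hA' hr
    exact ⟨e, he, hdvd⟩
  rw [hcop_ac.card_divisors_mul, card_divisors_of_squarefree hsa',
    card_divisors_sq_of_squarefree hsc, hcard] at hcount
  have hlow : smallPrimorial (p * a' * b).primeFactors.card * smallPrimorial b.primeFactors.card ≤
      2 ^ a'.primeFactors.card * 3 ^ c.primeFactors.card :=
    (Nat.mul_le_mul (smallPrimorial_le hsab) (smallPrimorial_le hsb)).trans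
      (by rwa [mul_assoc, ← sq])
  have hωa : (p * a').primeFactors.card = a'.primeFactors.card + 1 := by
    rw [card_primeFactors_mul_of_coprime hcop_p, hp.primeFactors, Finset.card_singleton, add_comm]
  have hωab : (p * a' * b).primeFactors.card = a'.primeFactors.card + 1 + b.primeFactors.card := by
    rw [card_primeFactors_mul_of_coprime hcop_b, hωa]
  rw [hn, card_primeFactors_mul_of_coprime hcop_c, hωab] at h₂ h₃
  rw [hωab] at hlow
  have hcases : b.primeFactors.card = 0 ∧ (a'.primeFactors.card = 0 ∧ c.primeFactors.card ≤ 3 ∨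
      a'.primeFactors.card = 1 ∧ (c.primeFactors.card = 1 ∨ c.primeFactors.card = 2)) := by
    clear hωa hωab hcount
    generalize a'.primeFactors.card = v at *
    generalize b.primeFactors.card = z at *
    generalize c.primeFactors.card = u at *
    have : v ≤ 3 := by omega
    have : z ≤ 3 := by omega
    have : u ≤ 3 := by omega
    clear hcard
    interval_cases v <;> interval_cases z <;> interval_cases u <;>
      simp [smallPrimorial] at hlow h₂ h₃ ⊢
  obtain ⟨hb, hac⟩ := hcases
  obtain rfl : b = 1 := by
    rw [Finset.card_eq_zero, Nat.primeFactors_eq_empty] at hb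
    exact hb.resolve_left hsb.ne_zero
  rw [one_pow, mul_one] at hcard
  rw [mul_one] at hn
  rcases hac with ⟨ha', hc⟩ | ⟨ha', hc⟩
  · obtain rfl : a' = 1 := by
      rw [Finset.card_eq_zero, Nat.primeFactors_eq_empty] at ha'
      exact ha'.resolve_left hsa'.ne_zero
    rw [mul_one] at hcard hn
    exact hP.false_of_card_prime hp hn h₁ hcard (by simpa using hA) hc
  · have hpa := exists_prime_of_card_primeFactors hsa' ha'
    rcases lt_trichotomy a' p with hlt | heq | hlt
    · exact hP.false_of_card_two_primes hp hpa hlt hn h₁ hcard hA' hc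
    · exact (Nat.Prime.coprime_iff_not_dvd hp).1 hcop_p heq.symm.dvd
    · exact hP.false_of_card_two_primes hpa hp hlt (by rw [hn, mul_comm p]) h₁
        (by rw [hcard, mul_comm]) (fun r hr => by rw [hA r hr]; ring) hc
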